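/- arXiv:1902.10365 — 4 statements merged into one kernel-verified Lean document; each statement's English description precedes it below -/
import Mathlib

section
/- Let 𝒳 be a measurable space and k : 𝒳 × 𝒳 → ℝ a measurable, symmetric, positive semidefinite kernel with sup_{x,y∈𝒳} |k(x,y)| ≤ M. Then for all Borel probability measures P, P', Q, Q' on 𝒳: |MMD_k(P,Q) − MMD_k(P',Q')| ≤ 2√M · ( D_TV(P,P') + D_TV(Q,Q') ). -/
open MeasureTheory

/-- Total variation distance between two measures:
`D_TV(P,Q) = sup_A |P(A) - Q(A)|` over measurable sets `A`. -/
noncomputable def tvDist {X : Type*} [MeasurableSpace X] (P Q : Measure X) : ℝ :=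
  ⨆ A : {s : Set X // MeasurableSet s}, |(P A).toReal - (Q A).toReal|

/-- A kernel `k : X × X → ℝ` is positive semidefinite if all its Gram quadratic
forms are nonnegative. -/
def IsPSDKernel {X : Type*} (k : X × X → ℝ) : Prop :=
  ∀ (n : ℕ) (x : Fin n → X) (a : Fin n → ℝ),
    0 ≤ ∑ i : Fin n, ∑ j : Fin n, a i * a j * k (x i, x j)

/-- Maximum mean discrepancy:
`MMD_k(P,Q) = ( ∬ k d(P⊗P) + ∬ k d(Q⊗Q) − 2 ∬ k d(P⊗Q) )^{1/2}`. -/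
noncomputable def mmd {X : Type*} [MeasurableSpace X] (k : X × X → ℝ)
    (P Q : Measure X) : ℝ :=
  Real.sqrt ((∫ z, k z ∂(P.prod P)) + (∫ z, k z ∂(Q.prod Q))
    - 2 * ∫ z, k z ∂(P.prod Q))

open ProbabilityTheory in
lemma psd_integral_aux {X : Type*} [MeasurableSpace X] (K : X × X → ℝ) (hpsd : IsPSDKernel K)
    (μ : Measure X) [IsProbabilityMeasure μ] (hK : Integrable K (μ.prod μ))
    (hD : Integrable (fun x => K (x, x)) μ) : 0 ≤ ∫ z, K z ∂(μ.prod μ) := by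
  set I := ∫ z, K z ∂(μ.prod μ) with hI
  set D := ∫ x, K (x, x) ∂μ with hDdef
  have key : ∀ n : ℕ, 0 ≤ (n : ℝ) * (n * I + (D - I)) := by
    intro n
    let π : Measure (Fin n → X) := Measure.pi (fun _ => μ)
    have hmap : ∀ i j : Fin n, i ≠ j → π.map (fun ω => (ω i, ω j)) = μ.prod μ := by
      intro i j hij
      have h := (iIndepFun_pi (μ := fun _ : Fin n => μ) (X := fun _ x => x)
        (fun _ => aemeasurable_id)).indepFun hij
      have h2 := (indepFun_iff_map_prod_eq_prod_map_map
        (measurable_pi_apply i).aemeasurable (measurable_pi_apply j).aemeasurable).1 h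
      have e : ∀ i : Fin n, π.map (fun ω => ω i) = μ := fun i =>
        (measurePreserving_eval (fun _ : Fin n => μ) i).map_eq
      rw [e i, e j] at h2
      exact h2
    have hmapd : ∀ i : Fin n, π.map (fun ω => ω i) = μ := fun i =>
        (measurePreserving_eval (fun _ : Fin n => μ) i).map_eq
    have hm : ∀ i j : Fin n, Measurable (fun ω : Fin n → X => (ω i, ω j)) := by
      intro i j; fun_prop
    have hterm : ∀ i j : Fin n, Integrable (fun ω => K (ω i, ω j)) π ∧
        ∫ ω, K (ω i, ω j) ∂π = I + (if i = j then D - I else 0) := by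
      intro i j
      by_cases hij : i = j
      · subst hij
        rw [← hmapd i] at hD
        refine ⟨(integrable_map_measure hD.1 (measurable_pi_apply i).aemeasurable).1 hD, ?_⟩
        have := integral_map (μ := π) (φ := fun ω : Fin n → X => ω i)
          (measurable_pi_apply i).aemeasurable hD.1
        rw [← this, hmapd i]; simp [hDdef]
      · rw [← hmap i j hij] at hK
        refine ⟨(integrable_map_measure hK.1 (hm i j).aemeasurable).1 hK, ?_⟩
        have := integral_map (hm i j).aemeasurable hK.1
        rw [← this, hmap i j hij]; simp [hij, hI]
    have h0 : 0 ≤ ∫ ω, ∑ i : Fin n, ∑ j : Fin n, K (ω i, ω j) ∂π := by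
      refine integral_nonneg fun ω => ?_
      have := hpsd n ω (fun _ => 1)
      simpa using this
    rw [integral_finsetSum _ (fun i _ => integrable_finsetSum _ fun j _ => (hterm i j).1)] at h0
    simp_rw [integral_finsetSum _ (fun j _ => (hterm _ j).1), (hterm _ _).2] at h0
    simpa [Finset.sum_add_distrib, mul_add] using h0
  by_contra hneg
  push Not at hneg
  obtain ⟨n, hn⟩ := exists_nat_gt (max 0 ((D - I) / (-I)))
  have hn0 : (0 : ℝ) < n := lt_of_le_of_lt (le_max_left _ _) hn
  have hn1 : (D - I) / (-I) < n := lt_of_le_of_lt (le_max_right _ _) hn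
  rw [div_lt_iff₀ (by linarith)] at hn1
  have := key n
  nlinarith [mul_pos hn0 (show 0 < -(n * I + (D - I)) by linarith)]

lemma psd_integral_fin {X : Type*} [MeasurableSpace X] (K : X × X → ℝ) (hpsd : IsPSDKernel K)
    (ν : Measure X) [IsFiniteMeasure ν] (hK : Integrable K (ν.prod ν))
    (hD : Integrable (fun x => K (x, x)) ν) : 0 ≤ ∫ z, K z ∂(ν.prod ν) := by
  by_cases h0 : ν = 0
  · subst h0; simp
  have : NeZero ν := ⟨h0⟩
  set c := (ν Set.univ)⁻¹ with hc
  have hc0 : ν Set.univ ≠ 0 := by simpa using h0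
  have hct : ν Set.univ ≠ ⊤ := measure_ne_top _ _
  have hcne : c ≠ ⊤ := ENNReal.inv_ne_top.2 hc0
  have hcpos : 0 < c.toReal := ENNReal.toReal_pos (ENNReal.inv_ne_zero.2 hct) hcne
  have hp : IsProbabilityMeasure (c • ν) := ⟨by
    simp only [Measure.smul_apply, smul_eq_mul, hc]; exact ENNReal.inv_mul_cancel hc0 hct⟩
  have e : (c • ν).prod (c • ν) = c • c • (ν.prod ν) := by
    rw [Measure.prod_smul_left, Measure.prod_smul_right]
  have h := psd_integral_aux K hpsd (c • ν)
    (by rw [e]; exact (hK.smul_measure hcne).smul_measure hcne) (hD.smul_measure hcne)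
  rw [e, integral_smul_measure, integral_smul_measure, smul_eq_mul, smul_eq_mul] at h
  exact (mul_nonneg_iff_of_pos_left hcpos).1 ((mul_nonneg_iff_of_pos_left hcpos).1 h)

lemma abs_le_tvDist {X : Type*} [MeasurableSpace X] (P Q : Measure X)
    [IsProbabilityMeasure P] [IsProbabilityMeasure Q] (A : Set X) (hA : MeasurableSet A) :
    |P.real A - Q.real A| ≤ tvDist P Q := by
  refine le_ciSup (f := fun A : {s : Set X // MeasurableSet s} =>
    |(P A).toReal - (Q A).toReal|) ⟨1, ?_⟩ ⟨A, hA⟩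
  rintro _ ⟨B, rfl⟩
  have h1 : (P B).toReal ≤ 1 := measureReal_le_one
  have h2 : (Q B).toReal ≤ 1 := measureReal_le_one
  have h3 : 0 ≤ (P B).toReal := ENNReal.toReal_nonneg
  have h4 : 0 ≤ (Q B).toReal := ENNReal.toReal_nonneg
  exact abs_le.2 ⟨by linarith, by linarith⟩

lemma tvDist_symm' {X : Type*} [MeasurableSpace X] (P Q : Measure X) :
    tvDist P Q = tvDist Q P := by
  unfold tvDist
  simp_rw [abs_sub_comm]

lemma integral_abs_le_tv {X : Type*} [MeasurableSpace X] (P Q ν : Measure X)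
    [IsProbabilityMeasure P] [IsProbabilityMeasure Q] [IsFiniteMeasure ν]
    (hP : P ≪ ν) (hQ : Q ≪ ν) :
    ∫ x, |(P.rnDeriv ν x).toReal - (Q.rnDeriv ν x).toReal| ∂ν ≤ 2 * tvDist P Q := by
  set p := fun x => (P.rnDeriv ν x).toReal with hp
  set q := fun x => (Q.rnDeriv ν x).toReal with hq
  have mp : Measurable p := (Measure.measurable_rnDeriv _ _).ennreal_toReal
  have mq : Measurable q := (Measure.measurable_rnDeriv _ _).ennreal_toReal
  have ip : Integrable p ν := Measure.integrable_toReal_rnDeriv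
  have iq : Integrable q ν := Measure.integrable_toReal_rnDeriv
  let A : Set X := {x | q x ≤ p x}
  have hA : MeasurableSet A := measurableSet_le mq mp
  have e : ∀ B : Set X, ∫ x in B, (p x - q x) ∂ν = P.real B - Q.real B := by
    intro B
    rw [integral_sub ip.integrableOn iq.integrableOn,
      Measure.setIntegral_toReal_rnDeriv hP, Measure.setIntegral_toReal_rnDeriv hQ]
  change ∫ x, |p x - q x| ∂ν ≤ _
  have iabs : Integrable (fun x => |p x - q x|) ν := (ip.sub iq).abs
  rw [← integral_add_compl hA iabs]
  have e1 : ∫ x in A, |p x - q x| ∂ν = ∫ x in A, (p x - q x) ∂ν :=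
    setIntegral_congr_fun hA fun x hx => abs_of_nonneg (sub_nonneg.2 hx)
  have e2 : ∫ x in Aᶜ, |p x - q x| ∂ν = ∫ x in Aᶜ, -(p x - q x) ∂ν :=
    setIntegral_congr_fun hA.compl fun x hx =>
      abs_of_nonpos (sub_nonpos.2 (le_of_lt (not_le.1 hx)))
  have h1 := abs_le_tvDist P Q A hA
  have h2 := abs_le_tvDist P Q Aᶜ hA.compl
  have : ∫ x in A, |p x - q x| ∂ν + ∫ x in Aᶜ, |p x - q x| ∂ν ≤ 2 * tvDist P Q := by
    rw [e1, e2, integral_neg, e, e]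
    linarith [(abs_le.1 h1).2, (abs_le.1 h2).1]
  exact this

/-- The bilinear form induced by the kernel on functions. -/
noncomputable def bform {X : Type*} [MeasurableSpace X] (k : X × X → ℝ) (ν : Measure X)
    (f g : X → ℝ) : ℝ := ∫ z, f z.1 * g z.2 * k z ∂(ν.prod ν)

section bform
variable {X : Type*} [MeasurableSpace X] {k : X × X → ℝ} {M : ℝ} {ν : Measure X}
  [IsFiniteMeasure ν] {f g h : X → ℝ}

lemma bform_integrable (hk : Measurable k) (hbdd : ∀ x y : X, |k (x, y)| ≤ M)
    (hf : Integrable f ν) (hg : Integrable g ν) :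
    Integrable (fun z : X × X => f z.1 * g z.2 * k z) (ν.prod ν) :=
  (hf.mul_prod hg).mul_bdd hk.aestronglyMeasurable (ae_of_all _ fun z => hbdd z.1 z.2)

lemma bform_symm (hsym : ∀ x y : X, k (x, y) = k (y, x)) : bform k ν f g = bform k ν g f := by
  unfold bform
  rw [← integral_prod_swap]
  refine integral_congr_ae (ae_of_all _ fun z => ?_)
  simp only [Prod.fst_swap, Prod.snd_swap]
  rw [show k z.swap = k z from hsym _ _]; ring

lemma bform_expand (hk : Measurable k) (hbdd : ∀ x y : X, |k (x, y)| ≤ M)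
    (hsym : ∀ x y : X, k (x, y) = k (y, x))
    (hf : Integrable f ν) (hg : Integrable g ν) (t : ℝ) :
    bform k ν (fun x => f x + t * g x) (fun x => f x + t * g x) =
      bform k ν f f + 2 * t * bform k ν f g + t ^ 2 * bform k ν g g := by
  have i1 := bform_integrable hk hbdd hf hf
  have i2 := (bform_integrable hk hbdd hf hg).const_mul t
  have i3 := (bform_integrable hk hbdd hg hf).const_mul t
  have i4 := (bform_integrable hk hbdd hg hg).const_mul (t ^ 2)
  have i12 : Integrable (fun z : X × X => f z.1 * f z.2 * k z + t * (f z.1 * g z.2 * k z))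
    (ν.prod ν) := i1.add i2
  have i123 : Integrable (fun z : X × X => f z.1 * f z.2 * k z + t * (f z.1 * g z.2 * k z)
    + t * (g z.1 * f z.2 * k z)) (ν.prod ν) := i12.add i3
  have : bform k ν (fun x => f x + t * g x) (fun x => f x + t * g x) =
      bform k ν f f + t * bform k ν f g + t * bform k ν g f + t ^ 2 * bform k ν g g := by
    unfold bform
    rw [← integral_const_mul, ← integral_const_mul, ← integral_const_mul,
      ← integral_add i1 i2, ← integral_add i12 i3, ← integral_add i123 i4]
    refine integral_congr_ae (ae_of_all _ fun z => ?_)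
    simp only
    ring
  rw [this, bform_symm (f := g) (g := f) hsym]; ring

lemma bform_nonneg (hk : Measurable k) (hbdd : ∀ x y : X, |k (x, y)| ≤ M)
    (hpsd : IsPSDKernel k) (hf : MemLp f 2 ν) : 0 ≤ bform k ν f f := by
  have hf1 : Integrable f ν := hf.integrable (by norm_num)
  refine psd_integral_fin (fun z => f z.1 * f z.2 * k z) ?_ ν
    (bform_integrable hk hbdd hf1 hf1) ?_
  · intro n x a
    refine (hpsd n x (fun i => a i * f (x i))).trans_eq ?_
    refine Finset.sum_congr rfl fun i _ => Finset.sum_congr rfl fun j _ => ?_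
    simp only; ring
  · have : Integrable (fun x => f x * f x) ν := by simpa [sq] using hf.integrable_sq
    exact this.mul_bdd (c := M) (hk.comp (measurable_id.prodMk measurable_id)).aestronglyMeasurable
      (ae_of_all _ fun z => hbdd z z)

lemma bform_triangle (hk : Measurable k) (hbdd : ∀ x y : X, |k (x, y)| ≤ M)
    (hsym : ∀ x y : X, k (x, y) = k (y, x))
    (hpsd : IsPSDKernel k) (hf : MemLp f 2 ν) (hg : MemLp g 2 ν) :
    √(bform k ν (fun x => f x + g x) (fun x => f x + g x)) ≤
      √(bform k ν f f) + √(bform k ν g g) := by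
  have hf1 : Integrable f ν := hf.integrable (by norm_num)
  have hg1 : Integrable g ν := hg.integrable (by norm_num)
  have nf := bform_nonneg hk hbdd hpsd hf
  have ng := bform_nonneg hk hbdd hpsd hg
  have cs : discrim (bform k ν g g) (2 * bform k ν f g) (bform k ν f f) ≤ 0 := by
    refine discrim_le_zero fun t => ?_
    have := bform_nonneg hk hbdd hpsd (hf.add (hg.const_mul t))
    have h2 := bform_expand hk hbdd hsym hf1 hg1 t
    have h3 : 0 ≤ bform k ν (fun x => f x + t * g x) (fun x => f x + t * g x) := this
    rw [h2] at h3
    linarith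
  unfold discrim at cs
  have cs' : bform k ν f g ≤ √(bform k ν f f) * √(bform k ν g g) := by
    rw [← Real.sqrt_mul nf]
    exact Real.le_sqrt_of_sq_le (by nlinarith)
  have h1 := bform_expand hk hbdd hsym hf1 hg1 1
  simp only [one_mul, mul_one, one_pow] at h1
  rw [h1]
  refine Real.sqrt_le_iff.2 ⟨by positivity, ?_⟩
  nlinarith [Real.sq_sqrt nf, Real.sq_sqrt ng]

lemma bform_le (hk : Measurable k) (hbdd : ∀ x y : X, |k (x, y)| ≤ M)
    (hf : Integrable f ν) : bform k ν f f ≤ M * (∫ x, |f x| ∂ν) ^ 2 := by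
  have : M * (∫ x, |f x| ∂ν) ^ 2 = ∫ z, |f z.1| * |f z.2| * M ∂(ν.prod ν) := by
    rw [integral_mul_const, integral_prod_mul (fun x => |f x|) (fun x => |f x|)]; ring
  rw [this]
  refine integral_mono (bform_integrable hk hbdd hf hf) ((hf.abs.mul_prod hf.abs).mul_const M) ?_
  intro z
  calc f z.1 * f z.2 * k z ≤ |f z.1 * f z.2 * k z| := le_abs_self _
    _ = |f z.1| * |f z.2| * |k z| := by rw [abs_mul, abs_mul]
    _ ≤ |f z.1| * |f z.2| * M := by gcongr; exact hbdd z.1 z.2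

lemma bform_rnDeriv (hk : Measurable k) (hbdd : ∀ x y : X, |k (x, y)| ≤ M)
    (P Q : Measure X) [IsProbabilityMeasure P] [IsProbabilityMeasure Q]
    (hP : P ≪ ν) (hQ : Q ≪ ν) :
    ∫ z, k z ∂(P.prod Q) =
      bform k ν (fun x => (P.rnDeriv ν x).toReal) (fun x => (Q.rnDeriv ν x).toReal) := by
  have ik : Integrable k (P.prod Q) :=
    Integrable.of_bound hk.aestronglyMeasurable M (ae_of_all _ fun z => hbdd z.1 z.2)
  unfold bform
  rw [integral_prod _ ik, integral_prod _ (bform_integrable hk hbdd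
    Measure.integrable_toReal_rnDeriv Measure.integrable_toReal_rnDeriv),
    ← integral_toReal_rnDeriv_mul hP]
  refine integral_congr_ae (ae_of_all _ fun x => ?_)
  simp only
  rw [← integral_toReal_rnDeriv_mul hQ, ← integral_const_mul]
  simp only [mul_assoc]

lemma mmd_eq (hk : Measurable k) (hbdd : ∀ x y : X, |k (x, y)| ≤ M)
    (hsym : ∀ x y : X, k (x, y) = k (y, x))
    (P Q : Measure X) [IsProbabilityMeasure P] [IsProbabilityMeasure Q]
    (hP : P ≪ ν) (hQ : Q ≪ ν) :
    mmd k P Q = √(bform k ν (fun x => (P.rnDeriv ν x).toReal - (Q.rnDeriv ν x).toReal)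
      (fun x => (P.rnDeriv ν x).toReal - (Q.rnDeriv ν x).toReal)) := by
  have := bform_expand (ν := ν) hk hbdd hsym (f := fun x => (P.rnDeriv ν x).toReal)
    (g := fun x => (Q.rnDeriv ν x).toReal)
    Measure.integrable_toReal_rnDeriv Measure.integrable_toReal_rnDeriv (-1)
  simp only [neg_mul, one_mul, ← sub_eq_add_neg] at this
  rw [this]
  unfold mmd
  rw [bform_rnDeriv hk hbdd P P hP hP, bform_rnDeriv hk hbdd P Q hP hQ,
    bform_rnDeriv hk hbdd Q Q hQ hQ]
  congr 1; ring

lemma memLp_rn (P : Measure X) (hP : P ≤ ν) :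
    MemLp (fun x => (P.rnDeriv ν x).toReal) 2 ν := by
  refine MemLp.of_bound
    (Measure.measurable_rnDeriv _ _).ennreal_toReal.aestronglyMeasurable 1 ?_
  filter_upwards [Measure.rnDeriv_le_one_of_le hP] with x hx
  rw [Real.norm_of_nonneg ENNReal.toReal_nonneg]
  exact ENNReal.toReal_le_of_le_ofReal zero_le_one (by simpa using hx)

end bform

lemma mmd_le_aux {X : Type*} [MeasurableSpace X]
    (k : X × X → ℝ) (M : ℝ) (hk : Measurable k)
    (hsym : ∀ x y : X, k (x, y) = k (y, x)) (hpsd : IsPSDKernel k)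
    (hbdd : ∀ x y : X, |k (x, y)| ≤ M)
    (P P' Q Q' : Measure X)
    [IsProbabilityMeasure P] [IsProbabilityMeasure P']
    [IsProbabilityMeasure Q] [IsProbabilityMeasure Q'] :
    mmd k P Q ≤ mmd k P' Q' + 2 * Real.sqrt M * (tvDist P P' + tvDist Q Q') := by
  let ν : Measure X := (P + P') + (Q + Q')
  have lP : P ≤ ν := (Measure.le_add_right le_rfl).trans (Measure.le_add_right le_rfl)
  have lP' : P' ≤ ν := (Measure.le_add_left le_rfl).trans (Measure.le_add_right le_rfl)
  have lQ : Q ≤ ν := (Measure.le_add_right le_rfl).trans (Measure.le_add_left le_rfl)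
  have lQ' : Q' ≤ ν := (Measure.le_add_left le_rfl).trans (Measure.le_add_left le_rfl)
  have aP := lP.absolutelyContinuous
  have aP' := lP'.absolutelyContinuous
  have aQ := lQ.absolutelyContinuous
  have aQ' := lQ'.absolutelyContinuous
  have mP := memLp_rn P lP
  have mP' := memLp_rn P' lP'
  have mQ := memLp_rn Q lQ
  have mQ' := memLp_rn Q' lQ'
  rw [mmd_eq hk hbdd hsym P Q aP aQ, mmd_eq hk hbdd hsym P' Q' aP' aQ']
  have tP := integral_abs_le_tv P P' ν aP aP'
  have tQ := integral_abs_le_tv Q Q' ν aQ aQ'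
  set p := fun x => (P.rnDeriv ν x).toReal
  set p' := fun x => (P'.rnDeriv ν x).toReal
  set q := fun x => (Q.rnDeriv ν x).toReal
  set q' := fun x => (Q'.rnDeriv ν x).toReal
  let r := fun x => (p x - p' x) - (q x - q' x)
  have mr : MemLp r 2 ν := (mP.sub mP').sub (mQ.sub mQ')
  have tri := bform_triangle hk hbdd hsym hpsd (mP'.sub mQ') mr
  have e : (fun x => (p' - q') x + r x) = fun x => p x - q x := by
    funext x; simp only [r, Pi.sub_apply]; ring
  rw [e] at tri
  have ir : Integrable r ν := mr.integrable (by norm_num)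
  have i1 : Integrable (fun x => |p x - p' x|) ν :=
    ((mP.sub mP').integrable (by norm_num)).abs
  have i2 : Integrable (fun x => |q x - q' x|) ν :=
    ((mQ.sub mQ').integrable (by norm_num)).abs
  have hr : ∫ x, |r x| ∂ν ≤ 2 * (tvDist P P' + tvDist Q Q') := by
    have : ∫ x, |r x| ∂ν ≤ ∫ x, (|p x - p' x| + |q x - q' x|) ∂ν :=
      integral_mono ir.abs (i1.add i2) fun x => abs_sub _ _
    rw [integral_add i1 i2] at this
    linarith
  have hM : 0 ≤ M := by
    obtain ⟨x⟩ := nonempty_of_isProbabilityMeasure P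
    exact (abs_nonneg _).trans (hbdd x x)
  have hb : √(bform k ν r r) ≤ √M * ∫ x, |r x| ∂ν := by
    refine (Real.sqrt_le_sqrt (bform_le hk hbdd ir)).trans_eq ?_
    rw [Real.sqrt_mul hM, Real.sqrt_sq (integral_nonneg fun x => abs_nonneg _)]
  have hfin := mul_le_mul_of_nonneg_left hr (Real.sqrt_nonneg M)
  change √(bform k ν (fun x => p x - q x) (fun x => p x - q x)) ≤
    √(bform k ν (p' - q') (p' - q')) + _
  linarith

/-- For a measurable, symmetric, PSD kernel `k` bounded by `M`, and all
Borel probability measures `P, P', Q, Q'`: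
`|MMD_k(P,Q) − MMD_k(P',Q')| ≤ 2√M (D_TV(P,P') + D_TV(Q,Q'))`. -/
theorem mmd_tv_lipschitz {X : Type*} [MeasurableSpace X]
    (k : X × X → ℝ) (M : ℝ) (hk : Measurable k)
    (hsym : ∀ x y : X, k (x, y) = k (y, x)) (hpsd : IsPSDKernel k)
    (hbdd : ∀ x y : X, |k (x, y)| ≤ M)
    (P P' Q Q' : Measure X)
    [IsProbabilityMeasure P] [IsProbabilityMeasure P']
    [IsProbabilityMeasure Q] [IsProbabilityMeasure Q'] :
    |mmd k P Q - mmd k P' Q'| ≤ 2 * Real.sqrt M * (tvDist P P' + tvDist Q Q') := by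
  have h1 := mmd_le_aux k M hk hsym hpsd hbdd P P' Q Q'
  have h2 := mmd_le_aux k M hk hsym hpsd hbdd P' P Q' Q
  rw [tvDist_symm' P' P, tvDist_symm' Q' Q] at h2
  exact abs_le.2 ⟨by linarith, by linarith⟩
end

section
/- Let 𝒳 be a measurable space and k : 𝒳 × 𝒳 → ℝ a measurable, symmetric, positive semidefinite kernel with sup_{x,y∈𝒳} |k(x,y)| ≤ M. Let P and Q be Borel probability measures on 𝒳, let X₁,X₂,… be i.i.d. with law P and Y₁,Y₂,… be i.i.d. with law Q, all mutually independent, and for each n let P̂ⁿ and Q̂ⁿ be the empirical measures of the first n samples. Then MMD_k(P̂ⁿ,Q̂ⁿ) converges to MMD_k(P,Q) in probability: for every ε > 0, lim_{n→∞} ℙ( |MMD_k(P̂ⁿ,Q̂ⁿ) − MMD_k(P,Q)| > ε ) = 0. -/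
open MeasureTheory Filter

/-- The empirical measure `(1/n) ∑ᵢ δ_{xᵢ}` of the points `x₁,…,xₙ`. -/
noncomputable def empMeasure {X : Type*} [MeasurableSpace X] {n : ℕ}
    (x : Fin n → X) : Measure X :=
  (n : ENNReal)⁻¹ • ∑ i : Fin n, Measure.dirac (x i)

theorem vstat_second_moment {Z : Type*} [MeasurableSpace Z] (μ : Measure Z)
    [IsProbabilityMeasure μ] (g : Z × Z → ℝ) (hg : Measurable g) (B : ℝ)
    (hB : ∀ z, |g z| ≤ B) (h0 : ∫ z, g z ∂(μ.prod μ) = 0) (n : ℕ) :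
    ∫ ω, (∑ i : Fin n, ∑ j : Fin n, g (ω i, ω j)) ^ 2 ∂(Measure.pi fun _ : Fin n => μ)
      ≤ 6 * (n : ℝ) ^ 3 * B ^ 2 := by
  set ν := Measure.pi fun _ : Fin n => μ with hν
  have hind : ProbabilityTheory.iIndepFun (fun (i : Fin n) (ω : Fin n → Z) => ω i) ν :=
    ProbabilityTheory.iIndepFun_pi (X := fun _ z => z) (fun i => aemeasurable_id)
  have hgm : ∀ i j : Fin n, Measurable fun ω : Fin n → Z => g (ω i, ω j) := fun i j =>
    hg.comp (by fun_prop)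
  have hbd : ∀ i j k l : Fin n, ∀ ω : Fin n → Z,
      |g (ω i, ω j) * g (ω k, ω l)| ≤ B ^ 2 := by
    intro i j k l ω
    rw [abs_mul, sq]
    exact mul_le_mul (hB _) (hB _) (abs_nonneg _) ((abs_nonneg _).trans (hB (ω i, ω j)))
  have hInt : ∀ i j k l : Fin n,
      Integrable (fun ω : Fin n → Z => g (ω i, ω j) * g (ω k, ω l)) ν := by
    intro i j k l
    refine Integrable.of_bound ((hgm i j).mul (hgm k l)).aestronglyMeasurable (B ^ 2) ?_
    exact Eventually.of_forall (fun ω => hbd i j k l ω)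
  have hterm : ∀ i j k l : Fin n,
      ∫ ω, g (ω i, ω j) * g (ω k, ω l) ∂ν ≤
        ((if i = j then 1 else 0) + (if i = k then 1 else 0) + (if i = l then 1 else 0)
          + (if j = k then 1 else 0) + (if j = l then 1 else 0) + (if k = l then (1:ℝ) else 0))
            * B ^ 2 := by
    intro i j k l
    by_cases hd : i ≠ j ∧ i ≠ k ∧ i ≠ l ∧ j ≠ k ∧ j ≠ l ∧ k ≠ l
    · obtain ⟨hij, hik, hil, hjk, hjl, hkl⟩ := hd
      have hI := hind.indepFun_prodMk_prodMk (fun i => measurable_pi_apply i)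
        i j k l hik hil hjk hjl
      have hI2 := hI.comp hg hg
      have h1 := ProbabilityTheory.IndepFun.integral_fun_mul_eq_mul_integral hI2
        (hgm i j).aestronglyMeasurable (hgm k l).aestronglyMeasurable
      have hmap : ν.map (fun ω => (ω i, ω j)) = μ.prod μ := by
        rw [(hind.indepFun hij).map_prod_eq_prod_map_map
          (measurable_pi_apply i).aemeasurable (measurable_pi_apply j).aemeasurable]
        have e : ∀ i : Fin n, ν.map (fun ω => ω i) = μ := fun i =>
          (measurePreserving_eval (fun _ : Fin n => μ) i).map_eq
        rw [e, e]
      have hz : ∫ ω, g (ω i, ω j) ∂ν = 0 := by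
        rw [← h0, ← hmap, integral_map (by fun_prop) hg.aestronglyMeasurable]
      simp only [Function.comp_def] at h1
      rw [h1, hz]
      simp [hij, hik, hil, hjk, hjl, hkl]
    · have h1 : ∫ ω, g (ω i, ω j) * g (ω k, ω l) ∂ν ≤ B ^ 2 := by
        calc _ ≤ ∫ ω, B ^ 2 ∂ν := integral_mono (hInt i j k l) (integrable_const _)
                  (fun ω => (le_abs_self _).trans (hbd i j k l ω))
          _ = B ^ 2 := by simp
      refine h1.trans ?_
      apply le_mul_of_one_le_left (sq_nonneg B)
      have hp : ∀ a b : Fin n, 0 ≤ (if a = b then (1:ℝ) else 0) := fun a b => by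
        split_ifs <;> norm_num
      have p1 := hp i j
      have p2 := hp i k
      have p3 := hp i l
      have p4 := hp j k
      have p5 := hp j l
      have p6 := hp k l
      by_contra hlt
      apply hd
      refine ⟨?_, ?_, ?_, ?_, ?_, ?_⟩ <;>
      · intro h
        apply hlt
        rw [if_pos h] at *
        linarith
  calc _ = ∫ ω, ∑ i : Fin n, ∑ j : Fin n, ∑ k : Fin n, ∑ l : Fin n,
            g (ω i, ω j) * g (ω k, ω l) ∂ν := by
          congr 1
          ext ω
          rw [sq, Finset.sum_mul]
          refine Finset.sum_congr rfl fun i _ => ?_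
          rw [Finset.sum_mul]
          refine Finset.sum_congr rfl fun j _ => ?_
          simp only [Finset.mul_sum]
    _ = ∑ i : Fin n, ∑ j : Fin n, ∑ k : Fin n, ∑ l : Fin n,
            ∫ ω, g (ω i, ω j) * g (ω k, ω l) ∂ν := by
          rw [integral_finsetSum _ (fun i _ => integrable_finsetSum _ fun j _ =>
            integrable_finsetSum _ fun k _ => integrable_finsetSum _ fun l _ => hInt i j k l)]
          refine Finset.sum_congr rfl fun i _ => ?_
          rw [integral_finsetSum _ (fun j _ =>
            integrable_finsetSum _ fun k _ => integrable_finsetSum _ fun l _ => hInt i j k l)]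
          refine Finset.sum_congr rfl fun j _ => ?_
          rw [integral_finsetSum _ (fun k _ =>
            integrable_finsetSum _ fun l _ => hInt i j k l)]
          refine Finset.sum_congr rfl fun k _ => ?_
          rw [integral_finsetSum _ (fun l _ => hInt i j k l)]
    _ ≤ _ := Finset.sum_le_sum fun i _ => Finset.sum_le_sum fun j _ =>
          Finset.sum_le_sum fun k _ => Finset.sum_le_sum fun l _ => hterm i j k l
    _ = _ := by
          simp only [← Finset.sum_mul, Finset.sum_add_distrib]
          simp
          left
          ring

theorem vstat_tail {Z : Type*} [MeasurableSpace Z] (μ : Measure Z)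
    [IsProbabilityMeasure μ] (f : Z × Z → ℝ) (hf : Measurable f) (C : ℝ)
    (hC : ∀ z, |f z| ≤ C) (n : ℕ) (hn : 0 < n) (δ : ℝ) (hδ : 0 < δ) :
    (Measure.pi fun _ : Fin n => μ)
      {ω | δ ≤ |(n : ℝ)⁻¹ * ((n : ℝ)⁻¹ * ∑ i : Fin n, ∑ j : Fin n, f (ω i, ω j))
        - ∫ z, f z ∂(μ.prod μ)|} ≤ ENNReal.ofReal (24 * C ^ 2 / δ ^ 2 / n) := by
  set A := ∫ z, f z ∂(μ.prod μ) with hA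
  have hn' : (0 : ℝ) < n := by exact_mod_cast hn
  have hfi : Integrable f (μ.prod μ) :=
    Integrable.of_bound hf.aestronglyMeasurable C (Eventually.of_forall hC)
  have hAC : |A| ≤ C := by
    have := norm_integral_le_of_norm_le_const (μ := μ.prod μ) (f := f) (Eventually.of_forall hC)
    simpa using this
  have hg : Measurable fun z => f z - A := hf.sub_const A
  have hB : ∀ z, |f z - A| ≤ 2 * C := fun z => by
    have := abs_sub (f z) A
    linarith [hC z]
  have hm := vstat_second_moment μ (fun z => f z - A) hg (2 * C) hB
    (by rw [integral_sub hfi (integrable_const _)]; simp [hA]) n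
  set ν := Measure.pi fun _ : Fin n => μ with hν
  set S : (Fin n → Z) → ℝ := fun ω => ∑ i : Fin n, ∑ j : Fin n, (f (ω i, ω j) - A) with hS
  have hSm : Measurable S := by
    refine Finset.measurable_sum _ fun i _ => Finset.measurable_sum _ fun j _ => ?_
    exact hg.comp (g := fun z => f z - A) (f := fun ω : Fin n → Z => (ω i, ω j)) (by fun_prop)
  have hSb : ∀ ω, |S ω| ≤ n * (n * (2 * C)) := by
    intro ω
    calc |S ω| ≤ ∑ i : Fin n, ∑ j : Fin n, |f (ω i, ω j) - A| :=
          (Finset.abs_sum_le_sum_abs _ _).trans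
            (Finset.sum_le_sum fun i _ => Finset.abs_sum_le_sum_abs _ _)
      _ ≤ ∑ i : Fin n, ∑ j : Fin n, 2 * C :=
          Finset.sum_le_sum fun i _ => Finset.sum_le_sum fun j _ => hB _
      _ = _ := by simp
  have hSi : Integrable (fun ω => S ω ^ 2) ν := by
    refine Integrable.of_bound (hSm.pow_const 2).aestronglyMeasurable
      ((n * (n * (2 * C))) ^ 2) (Eventually.of_forall fun ω => ?_)
    rw [Real.norm_eq_abs, abs_pow]
    exact pow_le_pow_left₀ (abs_nonneg _) (hSb ω) 2
  have hmk := mul_meas_ge_le_integral_of_nonneg (μ := ν)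
    (Eventually.of_forall fun ω => sq_nonneg (S ω)) hSi ((δ * n ^ 2) ^ 2)
  have hset : {ω : Fin n → Z | δ ≤ |(n : ℝ)⁻¹ * ((n : ℝ)⁻¹ *
      ∑ i : Fin n, ∑ j : Fin n, f (ω i, ω j)) - A|} ⊆ {ω | (δ * n ^ 2) ^ 2 ≤ S ω ^ 2} := by
    intro ω hω
    simp only [Set.mem_ofPred_eq] at hω ⊢
    have e : S ω = (n : ℝ) ^ 2 * ((n : ℝ)⁻¹ * ((n : ℝ)⁻¹ *
      ∑ i : Fin n, ∑ j : Fin n, f (ω i, ω j)) - A) := by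
      simp only [hS, Finset.sum_sub_distrib]
      simp
      field_simp
    rw [← sq_abs (S ω)]
    apply pow_le_pow_left₀ (by positivity)
    rw [e, abs_mul, abs_of_pos (by positivity : (0:ℝ) < (n:ℝ) ^ 2), mul_comm]
    gcongr
  refine (measure_mono hset).trans ?_
  rw [← ofReal_measureReal]
  apply ENNReal.ofReal_le_ofReal
  have := hmk.trans hm
  rw [div_div, le_div_iff₀ (by positivity)]
  have h3 : (0:ℝ) < (n:ℝ) ^ 3 := by positivity
  refine le_of_mul_le_mul_left ?_ h3
  refine le_trans (le_of_eq ?_) (this.trans (le_of_eq ?_)) <;> ring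

theorem integral_empMeasure_prod {X : Type*} [MeasurableSpace X] (k : X × X → ℝ) (M : ℝ)
    (hk : Measurable k) (hbdd : ∀ x y : X, |k (x, y)| ≤ M) (n : ℕ) (hn : 0 < n)
    (x y : Fin n → X) :
    ∫ z, k z ∂((empMeasure x).prod (empMeasure y))
      = (n : ℝ)⁻¹ * ((n : ℝ)⁻¹ * ∑ i : Fin n, ∑ j : Fin n, k (x i, y j)) := by
  have hfin : ∀ x : Fin n → X, IsFiniteMeasure (empMeasure x) := by
    intro x
    constructor
    unfold empMeasure
    simp only [Measure.smul_apply, smul_eq_mul, Measure.finsetSum_apply, measure_univ]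
    apply ENNReal.mul_lt_top
    · simp [hn]
    · simp
  have := hfin x
  have := hfin y
  have key : ∀ (x : Fin n → X) (h : X → ℝ), Measurable h → (∀ a, |h a| ≤ M) →
      ∫ a, h a ∂(empMeasure x) = (n : ℝ)⁻¹ * ∑ i : Fin n, h (x i) := by
    intro x h hh hb
    unfold empMeasure
    rw [integral_smul_measure, integral_finsetSum_measure]
    · simp only [integral_dirac' _ _ hh.stronglyMeasurable]
      simp
    · intro i _
      exact Integrable.of_bound hh.aestronglyMeasurable M (Eventually.of_forall hb)
  rw [integral_prod _ (Integrable.of_bound hk.aestronglyMeasurable M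
    (Eventually.of_forall fun z => hbdd z.1 z.2))]
  have e : ∀ a, ∫ b, k (a, b) ∂(empMeasure y) = (n : ℝ)⁻¹ * ∑ j : Fin n, k (a, y j) :=
    fun a => key y (fun b => k (a, b)) (hk.comp (by fun_prop)) (fun b => hbdd a b)
  simp only [e]
  rw [key x (fun a => (n : ℝ)⁻¹ * ∑ j : Fin n, k (a, y j))]
  · simp only [Finset.mul_sum]
  · refine Measurable.const_mul (Finset.measurable_sum _ fun j _ => hk.comp (by fun_prop)) _
  · intro a
    have hn' : (0 : ℝ) < n := by exact_mod_cast hn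
    rw [abs_mul, abs_of_pos (by positivity), inv_mul_le_iff₀ hn']
    calc _ ≤ ∑ j : Fin n, |k (a, y j)| := Finset.abs_sum_le_sum_abs _ _
      _ ≤ ∑ j : Fin n, M := Finset.sum_le_sum fun j _ => hbdd _ _
      _ = _ := by simp

theorem abs_sqrt_sub_sqrt_lt {a b ε : ℝ} (hε : 0 < ε)
    (h : ε < |Real.sqrt a - Real.sqrt b|) : ε ^ 2 ≤ |a - b| := by
  have main : ∀ a b : ℝ, ε < Real.sqrt a - Real.sqrt b → ε ^ 2 ≤ a - b := by
    intro a b h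
    have hb := Real.sqrt_nonneg b
    have ha : 0 < Real.sqrt a := by linarith
    have ha' := Real.sq_sqrt (Real.sqrt_pos.mp ha).le
    have hb' : b ≤ Real.sqrt b ^ 2 := by
      rcases le_total 0 b with h | h
      · rw [Real.sq_sqrt h]
      · exact h.trans (sq_nonneg _)
    nlinarith
  rcases lt_abs.mp h with h | h
  · exact (main a b h).trans (le_abs_self _)
  · rw [abs_sub_comm]
    exact (main b a (by linarith)).trans (le_abs_self _)

/-- Consistency of the empirical MMD (Theorem 1).  The first `n` i.i.d.
samples `X₁,…,Xₙ ~ P` and `Y₁,…,Yₙ ~ Q`, all mutually independent, are modelled by the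
product measure `(⊗ⁿ P) ⊗ (⊗ⁿ Q)`; the empirical MMD converges to `MMD_k(P,Q)` in
probability: for every `ε > 0` the probability of a deviation above `ε` tends to `0`. -/
theorem mmd_empirical_consistency {X : Type*} [MeasurableSpace X]
    (k : X × X → ℝ) (M : ℝ) (hk : Measurable k)
    (hsym : ∀ x y : X, k (x, y) = k (y, x)) (hpsd : IsPSDKernel k)
    (hbdd : ∀ x y : X, |k (x, y)| ≤ M)
    (P Q : Measure X) [IsProbabilityMeasure P] [IsProbabilityMeasure Q] :
    ∀ ε > (0 : ℝ),
      Tendsto (fun n : ℕ =>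
          ((Measure.pi fun _ : Fin n => P).prod (Measure.pi fun _ : Fin n => Q))
            {ω | ε < |mmd k (empMeasure ω.1) (empMeasure ω.2) - mmd k P Q|})
        atTop (nhds 0) := by
  intro ε hε
  set f : (X × X) × (X × X) → ℝ := fun z =>
    k (z.1.1, z.2.1) + k (z.1.2, z.2.2) - 2 * k (z.1.1, z.2.2) with hfdef
  have m1 : Measurable fun z : (X × X) × (X × X) => k (z.1.1, z.2.1) := hk.comp (by fun_prop)
  have m2 : Measurable fun z : (X × X) × (X × X) => k (z.1.2, z.2.2) := hk.comp (by fun_prop)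
  have m3 : Measurable fun z : (X × X) × (X × X) => k (z.1.1, z.2.2) := hk.comp (by fun_prop)
  have hf : Measurable f := (m1.add m2).sub (m3.const_mul 2)
  have hC : ∀ z, |f z| ≤ 4 * M := by
    intro z
    have h1 := abs_le.mp (hbdd z.1.1 z.2.1)
    have h2 := abs_le.mp (hbdd z.1.2 z.2.2)
    have h3 := abs_le.mp (hbdd z.1.1 z.2.2)
    rw [abs_le]
    constructor <;> simp only [hfdef] <;> linarith [h1.1, h1.2, h2.1, h2.2, h3.1, h3.2]
  set R := P.prod Q with hR
  have hInt : ∀ h : (X × X) × (X × X) → ℝ, Measurable h → (∀ z, |h z| ≤ M) →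
      Integrable h (R.prod R) := fun h hm hb =>
    Integrable.of_bound hm.aestronglyMeasurable M (Eventually.of_forall hb)
  have mpf : MeasurePreserving (Prod.fst : X × X → X) R P := measurePreserving_fst
  have mps : MeasurePreserving (Prod.snd : X × X → X) R Q := measurePreserving_snd
  have hA : ∫ z, f z ∂(R.prod R) = (∫ z, k z ∂(P.prod P)) + (∫ z, k z ∂(Q.prod Q))
      - 2 * ∫ z, k z ∂(P.prod Q) := by
    rw [← (mpf.prod mpf).map_eq, ← (mps.prod mps).map_eq]
    rw [show ∫ z, k z ∂(P.prod Q) = ∫ z, k z ∂((R.prod R).map (Prod.map Prod.fst Prod.snd)) by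
      rw [(mpf.prod mps).map_eq]]
    rw [integral_map (by fun_prop) hk.aestronglyMeasurable,
      integral_map (by fun_prop) hk.aestronglyMeasurable,
      integral_map (by fun_prop) hk.aestronglyMeasurable]
    simp only [hfdef]
    rw [integral_sub (f := fun z : (X × X) × (X × X) => k (z.1.1, z.2.1) + k (z.1.2, z.2.2))
      ((hInt _ m1 fun z => hbdd _ _).add (hInt _ m2 fun z => hbdd _ _))
      ((hInt _ m3 fun z => hbdd _ _).const_mul 2),
      integral_add (hInt _ m1 fun z => hbdd _ _) (hInt _ m2 fun z => hbdd _ _),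
      integral_const_mul]
    rfl
  have hbound : ∀ n : ℕ, 0 < n →
      ((Measure.pi fun _ : Fin n => P).prod (Measure.pi fun _ : Fin n => Q))
        {ω | ε < |mmd k (empMeasure ω.1) (empMeasure ω.2) - mmd k P Q|}
      ≤ ENNReal.ofReal (24 * (4 * M) ^ 2 / (ε ^ 2) ^ 2 / n) := by
    intro n hn
    rw [← (measurePreserving_arrowProdEquivProdArrow X X (Fin n)
      (fun _ => P) (fun _ => Q)).measure_preimage_equiv]
    refine le_trans (measure_mono ?_) (vstat_tail R f hf (4 * M) hC n hn (ε ^ 2) (by positivity))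
    intro ω hω
    simp only [Set.mem_preimage, Set.mem_ofPred_eq] at hω ⊢
    have h := abs_sqrt_sub_sqrt_lt hε hω
    rw [integral_empMeasure_prod k M hk hbdd n hn, integral_empMeasure_prod k M hk hbdd n hn,
      integral_empMeasure_prod k M hk hbdd n hn, ← hA] at h
    refine h.trans (le_of_eq ?_)
    congr 2
    simp only [hfdef, Finset.sum_sub_distrib, Finset.sum_add_distrib, ← Finset.mul_sum]
    simp only [MeasurableEquiv.arrowProdEquivProdArrow, MeasurableEquiv.coe_mk,
      Equiv.arrowProdEquivProdArrow, Equiv.coe_fn_mk]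
    ring
  have hlim : Tendsto (fun n : ℕ => ENNReal.ofReal (24 * (4 * M) ^ 2 / (ε ^ 2) ^ 2 / n))
      atTop (nhds 0) := by
    have := ENNReal.tendsto_ofReal
      (tendsto_const_div_atTop_nhds_zero_nat (24 * (4 * M) ^ 2 / (ε ^ 2) ^ 2))
    simpa using this
  refine tendsto_of_tendsto_of_tendsto_of_le_of_le' tendsto_const_nhds hlim
    (Eventually.of_forall fun n => zero_le) ?_
  filter_upwards [eventually_gt_atTop 0] with n hn
  exact hbound n hn
end

section
/- Let 𝒳 be a measurable space and let k¹,…,k^m : 𝒳 × 𝒳 → ℝ be measurable, symmetric, positive semidefinite kernels, each uniformly bounded. Let P and Q be Borel probability measures on 𝒳 with Σ_{j=1}^m MMD_{k^j}(P,Q) > 0, and for each ℓ define the mixing coefficient w_ℓ(P,Q) := MMD_{k^ℓ}(P,Q) / Σ_{j=1}^m MMD_{k^j}(P,Q) (with the convention that the ratio is 0 when the denominator is 0). Let X₁,X₂,… be i.i.d. with law P and Y₁,Y₂,… be i.i.d. with law Q, all mutually independent, with empirical measures P̂ⁿ, Q̂ⁿ of the first n samples. Then for every ℓ ∈ {1,…,m},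 w_ℓ(P̂ⁿ,Q̂ⁿ) converges to w_ℓ(P,Q) in probability as n → ∞. -/
open MeasureTheory Filter

/-- The MMD-based mixing coefficient
`w_ℓ(P,Q) = MMD_{k^ℓ}(P,Q) / Σⱼ MMD_{k^j}(P,Q)` (equal to `0` when the denominator
vanishes, via the real-division convention `x / 0 = 0`). -/
noncomputable def mixCoeff {X : Type*} [MeasurableSpace X] {m : ℕ}
    (k : Fin m → X × X → ℝ) (ℓ : Fin m) (P Q : Measure X) : ℝ :=
  mmd (k ℓ) P Q / ∑ j : Fin m, mmd (k j) P Q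


namespace MixAux
open ProbabilityTheory

lemma integ {Ω : Type*} [MeasurableSpace Ω] {μ : Measure Ω} [IsFiniteMeasure μ]
    {f : Ω → ℝ} (hf : Measurable f) {C : ℝ} (hC : ∀ x, |f x| ≤ C) : Integrable f μ :=
  Integrable.of_bound hf.aestronglyMeasurable C (Eventually.of_forall hC)

lemma cross_zero {Ω X β : Type*} [MeasurableSpace Ω] [MeasurableSpace X] [MeasurableSpace β]
    {μ : Measure Ω} [IsProbabilityMeasure μ] {P : Measure X} [IsProbabilityMeasure P]
    {U U' : Ω → X} {W : Ω → β} (hU : Measurable U) (hU' : Measurable U') (hW : Measurable W)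
    (hP : μ.map U = P) (hind : IndepFun U (fun ω => (U' ω, W ω)) μ)
    {h : X × β → ℝ} (hh : Measurable h) {C : ℝ} (hC : ∀ z, |h z| ≤ C)
    (h0 : ∀ z, ∫ x, h (x, z) ∂P = 0) :
    ∫ ω, h (U ω, W ω) * h (U' ω, W ω) ∂μ = 0 := by
  have hV : Measurable (fun ω => (U' ω, W ω)) := hU'.prodMk hW
  have hmap := (indepFun_iff_map_prod_eq_prod_map_map hU.aemeasurable hV.aemeasurable).1 hind
  have : IsProbabilityMeasure (μ.map (fun ω => (U' ω, W ω))) :=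
    Measure.isProbabilityMeasure_map hV.aemeasurable
  let F : X × (X × β) → ℝ := fun p => h (p.1, p.2.2) * h (p.2.1, p.2.2)
  have hF : Measurable F := by fun_prop
  have hFC : ∀ p, |F p| ≤ C * C := fun p => by
    simp only [F, abs_mul]
    exact mul_le_mul (hC _) (hC _) (abs_nonneg _) ((abs_nonneg _).trans (hC (p.1, p.2.2)))
  calc ∫ ω, h (U ω, W ω) * h (U' ω, W ω) ∂μ
      = ∫ ω, F (U ω, (U' ω, W ω)) ∂μ := rfl
    _ = ∫ p, F p ∂(μ.map (fun ω => (U ω, (U' ω, W ω)))) := by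
        rw [integral_map (hU.prodMk hV).aemeasurable hF.aestronglyMeasurable]
    _ = ∫ p, F p ∂(P.prod (μ.map (fun ω => (U' ω, W ω)))) := by rw [hmap, hP]
    _ = 0 := by
        rw [integral_prod_symm _ (integ hF hFC)]
        simp only [F, integral_mul_const, h0, zero_mul, integral_zero]

lemma sum_sq_le {Ω X β : Type*} [MeasurableSpace Ω] [MeasurableSpace X] [MeasurableSpace β]
    {μ : Measure Ω} [IsProbabilityMeasure μ] {P : Measure X} [IsProbabilityMeasure P] {n : ℕ}
    {U : Fin n → Ω → X} {W : Ω → β} (hU : ∀ i, Measurable (U i)) (hW : Measurable W)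
    (hP : ∀ i, μ.map (U i) = P)
    (hind : ∀ i i', i ≠ i' → IndepFun (U i) (fun ω => (U i' ω, W ω)) μ ∨
      IndepFun (U i') (fun ω => (U i ω, W ω)) μ)
    {h : X × β → ℝ} (hh : Measurable h) {C : ℝ} (hC : ∀ z, |h z| ≤ C)
    (h0 : ∀ z, ∫ x, h (x, z) ∂P = 0) :
    ∫ ω, (∑ i, h (U i ω, W ω)) ^ 2 ∂μ ≤ n * C ^ 2 := by
  have hm : ∀ i, Measurable fun ω => h (U i ω, W ω) := fun i => hh.comp ((hU i).prodMk hW)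
  have hCC : ∀ a b, |h a * h b| ≤ C * C := fun a b => by
    rw [abs_mul]
    exact mul_le_mul (hC _) (hC _) (abs_nonneg _) ((abs_nonneg _).trans (hC a))
  have hI : ∀ i i', Integrable (fun ω => h (U i ω, W ω) * h (U i' ω, W ω)) μ := fun i i' =>
    integ ((hm i).mul (hm i')) (fun ω => hCC _ _)
  have e : ∀ ω, (∑ i, h (U i ω, W ω)) ^ 2 = ∑ i, ∑ i', h (U i ω, W ω) * h (U i' ω, W ω) :=
    fun ω => by rw [sq, Finset.sum_mul_sum]
  simp_rw [e]
  rw [integral_finsetSum _ (fun i _ => integrable_finsetSum _ (fun i' _ => hI i i'))]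
  have : ∀ i, ∫ ω, ∑ i', h (U i ω, W ω) * h (U i' ω, W ω) ∂μ ≤ C ^ 2 := by
    intro i
    rw [integral_finsetSum _ (fun i' _ => hI i i'), Finset.sum_eq_single i]
    · calc _ ≤ ∫ _, C * C ∂μ := integral_mono (hI i i) (integrable_const _)
            (fun ω => (le_abs_self _).trans (hCC _ _))
        _ = C ^ 2 := by simp [sq]
    · intro i' _ hne
      rcases hind i i' hne.symm with h1 | h1
      · exact cross_zero (hU i) (hU i') hW (hP i) h1 hh hC h0
      · have := cross_zero (hU i') (hU i) hW (hP i') h1 hh hC h0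
        simpa only [mul_comm] using this
    · simp
  calc _ ≤ ∑ _i : Fin n, C ^ 2 := Finset.sum_le_sum fun i _ => this i
    _ = _ := by simp

/-- Second moment bound for V-statistics. -/
lemma vstat {Ω X : Type*} [MeasurableSpace Ω] [MeasurableSpace X]
    {μ : Measure Ω} [IsProbabilityMeasure μ] {P Q : Measure X} [IsProbabilityMeasure P]
    [IsProbabilityMeasure Q] {n : ℕ} (hn : 0 < n)
    {U V : Fin n → Ω → X} (hU : ∀ i, Measurable (U i)) (hV : ∀ i, Measurable (V i))
    (hP : ∀ i, μ.map (U i) = P) (hQ : ∀ i, μ.map (V i) = Q)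
    (hind : ∀ j i i', i ≠ i' → IndepFun (U i) (fun ω => (U i' ω, V j ω)) μ ∨
      IndepFun (U i') (fun ω => (U i ω, V j ω)) μ)
    (hindV : ∀ i i', i ≠ i' → IndepFun (V i) (V i') μ)
    {k : X × X → ℝ} (hk : Measurable k) {M : ℝ} (hM : ∀ z, |k z| ≤ M) :
    ∫ ω, ((n : ℝ)⁻¹ * ((n : ℝ)⁻¹ * ∑ i, ∑ j, k (U i ω, V j ω)) - ∫ z, k z ∂(P.prod Q)) ^ 2 ∂μ
      ≤ 16 * M ^ 2 / n := by
  have hn' : (0 : ℝ) < n := by exact_mod_cast hn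
  let g : X → ℝ := fun y => ∫ x, k (x, y) ∂P
  have hg : Measurable g :=
    (hk.stronglyMeasurable.integral_prod_left' (μ := P)).measurable
  have hgM : ∀ y, |g y| ≤ M := fun y => by
    have := norm_integral_le_of_norm_le_const (μ := P) (f := fun x => k (x, y)) (C := M)
      (Eventually.of_forall fun x => hM _)
    simpa using this
  set b := ∫ z, k z ∂(P.prod Q) with hb
  have hbg : b = ∫ y, g y ∂Q := integral_prod_symm _ (integ hk hM)
  have hbM : |b| ≤ M := by
    have := norm_integral_le_of_norm_le_const (μ := P.prod Q) (f := k) (C := M)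
      (Eventually.of_forall fun x => hM _)
    simpa using this
  let h : X × X → ℝ := fun p => k p - g p.2
  have hh : Measurable h := by fun_prop
  have hhC : ∀ z, |h z| ≤ 2 * M := fun z => by
    have := abs_sub (k z) (g z.2)
    have := hM z
    have := hgM z.2
    simp only [h]; linarith
  have h0 : ∀ z, ∫ x, h (x, z) ∂P = 0 := fun z => by
    simp only [h]
    rw [integral_sub (f := fun x => k (x, z)) (integ (hk.comp (by fun_prop)) (fun x => hM _))
      (integrable_const _)]
    simp [g]
  let h' : X × Unit → ℝ := fun p => g p.1 - b
  have hh' : Measurable h' := by fun_prop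
  have hhC' : ∀ z, |h' z| ≤ 2 * M := fun z => by
    have := abs_sub (g z.1) b
    have := hgM z.1
    simp only [h']; linarith
  have h0' : ∀ z, ∫ x, h' (x, z) ∂Q = 0 := fun z => by
    simp only [h']
    rw [integral_sub (integ hg hgM) (integrable_const _)]
    simp [hbg]
  have A : ∀ j, ∫ ω, (∑ i, h (U i ω, V j ω)) ^ 2 ∂μ ≤ n * (2 * M) ^ 2 := fun j =>
    sum_sq_le hU (hV j) hP (hind j) hh hhC h0
  have B : ∫ ω, (∑ i, h' (V i ω, ())) ^ 2 ∂μ ≤ n * (2 * M) ^ 2 :=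
    sum_sq_le (W := fun _ => ()) hV measurable_const hQ (fun i i' hi => Or.inl
      ((hindV i i' hi).comp (φ := id) (ψ := fun x => (x, ())) measurable_id (by fun_prop)))
      hh' hhC' h0'
  have bd : ∀ (f : Fin n → ℝ), (∀ i, |f i| ≤ 2 * M) → |(∑ i, f i) ^ 2| ≤ (n * (2 * M)) ^ 2 := by
    intro f hf
    rw [abs_pow]
    gcongr
    calc _ ≤ ∑ i, |f i| := Finset.abs_sum_le_sum_abs _ _
      _ ≤ ∑ _i : Fin n, 2 * M := Finset.sum_le_sum fun i _ => hf i
      _ = _ := by simp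
  have IA : ∀ j, Integrable (fun ω => (∑ i, h (U i ω, V j ω)) ^ 2) μ := fun j =>
    integ (by fun_prop) (fun ω => bd _ fun i => hhC _)
  have IB : Integrable (fun ω => (∑ i, h' (V i ω, ())) ^ 2) μ :=
    integ (by fun_prop) (fun ω => bd _ fun i => hhC' _)
  have key : ∀ ω, ((n : ℝ)⁻¹ * ((n : ℝ)⁻¹ * ∑ i, ∑ j, k (U i ω, V j ω)) - b) ^ 2 ≤
      2 * ((n : ℝ)⁻¹ ^ 3 * ∑ j, (∑ i, h (U i ω, V j ω)) ^ 2)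
        + 2 * ((n : ℝ)⁻¹ ^ 2 * (∑ i, h' (V i ω, ())) ^ 2) := by
    intro ω
    have e1 : (n : ℝ)⁻¹ * ((n : ℝ)⁻¹ * ∑ i, ∑ j, k (U i ω, V j ω)) - b =
        (n : ℝ)⁻¹ ^ 2 * ∑ j, ∑ i, h (U i ω, V j ω) + (n : ℝ)⁻¹ * ∑ i, h' (V i ω, ()) := by
      rw [Finset.sum_comm]
      simp only [h, h', Finset.sum_sub_distrib, Finset.sum_const, Finset.card_univ,
        Fintype.card_fin, nsmul_eq_mul, ← Finset.mul_sum]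
      field_simp
      ring
    have e2 : (∑ j, ∑ i, h (U i ω, V j ω)) ^ 2 ≤ n * ∑ j, (∑ i, h (U i ω, V j ω)) ^ 2 := by
      have := sq_sum_le_card_mul_sum_sq (s := Finset.univ)
        (f := fun j : Fin n => ∑ i, h (U i ω, V j ω))
      simpa using this
    rw [e1]
    have e3 : ((n : ℝ)⁻¹ ^ 2 * ∑ j, ∑ i, h (U i ω, V j ω)) ^ 2 ≤
        (n : ℝ)⁻¹ ^ 3 * ∑ j, (∑ i, h (U i ω, V j ω)) ^ 2 := by
      calc _ = (n : ℝ)⁻¹ ^ 4 * (∑ j, ∑ i, h (U i ω, V j ω)) ^ 2 := by ring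
        _ ≤ (n : ℝ)⁻¹ ^ 4 * (n * ∑ j, (∑ i, h (U i ω, V j ω)) ^ 2) := by gcongr
        _ = _ := by field_simp
    have e4 := add_sq_le (a := (n : ℝ)⁻¹ ^ 2 * ∑ j, ∑ i, h (U i ω, V j ω))
      (b := (n : ℝ)⁻¹ * ∑ i, h' (V i ω, ()))
    rw [mul_pow (n : ℝ)⁻¹] at e4
    linarith
  have I1 : Integrable (fun ω => 2 * ((n : ℝ)⁻¹ ^ 3 * ∑ j, (∑ i, h (U i ω, V j ω)) ^ 2)) μ :=
    ((integrable_finsetSum _ fun j _ => IA j).const_mul _).const_mul _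
  have I2 : Integrable (fun ω => 2 * ((n : ℝ)⁻¹ ^ 2 * (∑ i, h' (V i ω, ())) ^ 2)) μ :=
    (IB.const_mul _).const_mul _
  calc _ ≤ ∫ ω, (2 * ((n : ℝ)⁻¹ ^ 3 * ∑ j, (∑ i, h (U i ω, V j ω)) ^ 2)
        + 2 * ((n : ℝ)⁻¹ ^ 2 * (∑ i, h' (V i ω, ())) ^ 2)) ∂μ :=
        integral_mono_of_nonneg (Eventually.of_forall fun ω => sq_nonneg _) (I1.add I2)
          (Eventually.of_forall key)
    _ = 2 * ((n : ℝ)⁻¹ ^ 3 * ∑ j, ∫ ω, (∑ i, h (U i ω, V j ω)) ^ 2 ∂μ)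
        + 2 * ((n : ℝ)⁻¹ ^ 2 * ∫ ω, (∑ i, h' (V i ω, ())) ^ 2 ∂μ) := by
        rw [integral_add I1 I2]
        simp only [integral_const_mul]
        rw [integral_finsetSum _ fun j _ => IA j]
    _ ≤ 2 * ((n : ℝ)⁻¹ ^ 3 * ∑ _j : Fin n, n * (2 * M) ^ 2)
        + 2 * ((n : ℝ)⁻¹ ^ 2 * (n * (2 * M) ^ 2)) := by
        gcongr with j
        exact A j
    _ = _ := by
        simp only [Finset.sum_const, Finset.card_univ, Fintype.card_fin, nsmul_eq_mul]
        field_simp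
        ring

lemma integral_emp {X : Type*} [MeasurableSpace X] {n : ℕ} (x : Fin n → X)
    {f : X → ℝ} (hf : Measurable f) {M : ℝ} (hM : ∀ z, |f z| ≤ M) :
    ∫ z, f z ∂(empMeasure x) = (n : ℝ)⁻¹ * ∑ i, f (x i) := by
  unfold empMeasure
  rw [integral_smul_measure, integral_finsetSum_measure (fun i _ => integ hf hM)]
  simp [integral_dirac' _ _ hf.stronglyMeasurable]

lemma emp_finite {X : Type*} [MeasurableSpace X] {n : ℕ} (hn : 0 < n) (x : Fin n → X) :
    IsFiniteMeasure (empMeasure x) := by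
  constructor
  unfold empMeasure
  simp [ENNReal.mul_lt_top_iff, hn.ne', hn]

lemma integral_emp_prod {X : Type*} [MeasurableSpace X] {n : ℕ} (hn : 0 < n) (x y : Fin n → X)
    {k : X × X → ℝ} (hk : Measurable k) {M : ℝ} (hM : ∀ z, |k z| ≤ M) :
    ∫ z, k z ∂((empMeasure x).prod (empMeasure y)) =
      (n : ℝ)⁻¹ * ((n : ℝ)⁻¹ * ∑ i, ∑ j, k (x i, y j)) := by
  have := emp_finite hn x
  have := emp_finite hn y
  rw [integral_prod _ (integ hk hM)]
  have : ∀ a, ∫ b, k (a, b) ∂(empMeasure y) = (n : ℝ)⁻¹ * ∑ j, k (a, y j) := fun a =>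
    integral_emp y (f := fun b => k (a, b)) (hk.comp (by fun_prop)) (fun z => hM _)
  simp_rw [this]
  rw [integral_const_mul, integral_finsetSum]
  · have h2 : ∀ j, ∫ a, k (a, y j) ∂(empMeasure x) = (n : ℝ)⁻¹ * ∑ i, k (x i, y j) := fun j =>
      integral_emp x (f := fun a => k (a, y j)) (hk.comp (by fun_prop)) (fun z => hM _)
    simp_rw [h2]
    rw [← Finset.mul_sum, Finset.sum_comm]
  · intro j _
    exact integ (hk.comp (by fun_prop)) (fun z => hM _)

lemma indep_pi {X : Type*} [MeasurableSpace X] (P : Measure X) [IsProbabilityMeasure P] (n : ℕ) :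
    iIndepFun (fun i (ω : Fin n → X) => ω i) (Measure.pi fun _ : Fin n => P) :=
  iIndepFun_pi (X := fun _ x => x) (fun _ => aemeasurable_id)

lemma indep_pi_or {X : Type*} [MeasurableSpace X] (P : Measure X) [IsProbabilityMeasure P] (n : ℕ)
    (j i i' : Fin n) (h : i ≠ i') :
    IndepFun (fun ω : Fin n → X => ω i) (fun ω => (ω i', ω j)) (Measure.pi fun _ : Fin n => P) ∨
      IndepFun (fun ω : Fin n → X => ω i') (fun ω => (ω i, ω j))
        (Measure.pi fun _ : Fin n => P) := by
  by_cases hij : j = i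
  · right
    exact ((indep_pi P n).indepFun_prodMk (fun i => measurable_pi_apply i) i j i' h
      (hij ▸ h)).symm
  · left
    exact ((indep_pi P n).indepFun_prodMk (fun i => measurable_pi_apply i) i' j i h.symm hij).symm

lemma indep_cross {X : Type*} [MeasurableSpace X] (P Q : Measure X) [IsProbabilityMeasure P]
    [IsProbabilityMeasure Q] (n : ℕ) (j i i' : Fin n) (h : i ≠ i') :
    IndepFun (fun ω : (Fin n → X) × (Fin n → X) => ω.1 i) (fun ω => (ω.1 i', ω.2 j))
      ((Measure.pi fun _ : Fin n => P).prod (Measure.pi fun _ : Fin n => Q)) := by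
  set μ := Measure.pi fun _ : Fin n => P with hμ
  set ν := Measure.pi fun _ : Fin n => Q with hν
  have hP : ∀ i, μ.map (fun ω => ω i) = P := fun i =>
    (measurePreserving_eval (fun _ : Fin n => P) i).map_eq
  have hQ : ∀ i, ν.map (fun ω => ω i) = Q := fun i =>
    (measurePreserving_eval (fun _ : Fin n => Q) i).map_eq
  have h2 : μ.map (fun ω => (ω i, ω i')) = P.prod P := by
    have := (indepFun_iff_map_prod_eq_prod_map_map (measurable_pi_apply i).aemeasurable
      (measurable_pi_apply i').aemeasurable).1 ((indep_pi P n).indepFun h)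
    rw [this, ← hμ, hP, hP]
  rw [indepFun_iff_map_prod_eq_prod_map_map (by fun_prop) (by fun_prop)]
  have a1 : (μ.prod ν).map (fun ω => ω.1 i) = P := by
    have f1 : (μ.prod ν).map Prod.fst = μ := by simp
    rw [← hP i]
    nth_rewrite 2 [← f1]
    rw [Measure.map_map (by fun_prop) (by fun_prop)]
    rfl
  have a2 : (μ.prod ν).map (fun ω => (ω.1 i', ω.2 j)) = P.prod Q := by
    have := Measure.map_prod_map μ ν (f := fun ω : Fin n → X => ω i')
      (g := fun ω : Fin n → X => ω j) (by fun_prop) (by fun_prop)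
    rw [hP, hQ] at this
    exact this.symm
  have a3 : (μ.prod ν).map (fun ω => ((ω.1 i, ω.1 i'), ω.2 j)) = (P.prod P).prod Q := by
    have := Measure.map_prod_map μ ν (f := fun ω : Fin n → X => (ω i, ω i'))
      (g := fun ω : Fin n → X => ω j) (by fun_prop) (by fun_prop)
    rw [h2, hQ] at this
    exact this.symm
  rw [a1, a2, ← Measure.prodAssoc_prod, ← a3, Measure.map_map (by fun_prop) (by fun_prop)]
  rfl

lemma cheb {Ω : Type*} [MeasurableSpace Ω] {μ : Measure Ω} [IsProbabilityMeasure μ]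
    {T : Ω → ℝ} (hT : Measurable T) {C : ℝ} (hC : ∀ ω, |T ω| ≤ C) {B : ℝ}
    (hB : ∫ ω, T ω ^ 2 ∂μ ≤ B) {δ : ℝ} (hδ : 0 < δ) :
    μ {ω | δ ≤ |T ω|} ≤ ENNReal.ofReal (B / δ ^ 2) := by
  have hI : Integrable (fun ω => T ω ^ 2) μ := integ (C := C ^ 2) (by fun_prop) fun ω => by
    rw [abs_pow]; gcongr; exact hC ω
  have := mul_meas_ge_le_integral_of_nonneg (Eventually.of_forall fun ω => sq_nonneg (T ω)) hI
    (δ ^ 2)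
  have e : {ω | δ ^ 2 ≤ T ω ^ 2} = {ω | δ ≤ |T ω|} := by
    ext ω
    simp only [Set.mem_ofPred_eq]
    rw [sq_le_sq, abs_of_pos hδ]
  rw [e] at this
  rw [← ofReal_measureReal]
  apply ENNReal.ofReal_le_ofReal
  rw [le_div_iff₀ (by positivity)]
  linarith

/-- Convergence-rate bound for V-statistics. -/
lemma vstat_prob {Ω X : Type*} [MeasurableSpace Ω] [MeasurableSpace X]
    {μ : Measure Ω} [IsProbabilityMeasure μ] {P Q : Measure X} [IsProbabilityMeasure P]
    [IsProbabilityMeasure Q] {n : ℕ} (hn : 0 < n)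
    {U V : Ω → Fin n → X} (hU : Measurable U) (hV : Measurable V)
    (hP : ∀ i, μ.map (fun ω => U ω i) = P) (hQ : ∀ i, μ.map (fun ω => V ω i) = Q)
    (hind : ∀ j i i', i ≠ i' → IndepFun (fun ω => U ω i) (fun ω => (U ω i', V ω j)) μ ∨
      IndepFun (fun ω => U ω i') (fun ω => (U ω i, V ω j)) μ)
    (hindV : ∀ i i', i ≠ i' → IndepFun (fun ω => V ω i) (fun ω => V ω i') μ)
    {k : X × X → ℝ} (hk : Measurable k) {M : ℝ} (hM : ∀ z, |k z| ≤ M) {δ : ℝ} (hδ : 0 < δ) :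
    μ {ω | δ ≤ |∫ z, k z ∂((empMeasure (U ω)).prod (empMeasure (V ω)))
      - ∫ z, k z ∂(P.prod Q)|} ≤ ENNReal.ofReal (16 * M ^ 2 / n / δ ^ 2) := by
  simp_rw [integral_emp_prod hn _ _ hk hM]
  have hn' : (0 : ℝ) < n := by exact_mod_cast hn
  refine cheb (C := M + |∫ z, k z ∂(P.prod Q)|) (by fun_prop) ?_
    (vstat hn (U := fun i ω => U ω i) (V := fun i ω => V ω i) (by fun_prop) (by fun_prop)
      hP hQ hind hindV hk hM) hδ
  intro ω
  refine (abs_sub _ _).trans ?_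
  gcongr
  rw [abs_mul, abs_mul, abs_of_pos (inv_pos.2 hn')]
  have : |∑ i, ∑ j, k (U ω i, V ω j)| ≤ n * (n * M) := by
    calc _ ≤ ∑ i, |∑ j, k (U ω i, V ω j)| := Finset.abs_sum_le_sum_abs _ _
      _ ≤ ∑ i, ∑ j, |k (U ω i, V ω j)| :=
          Finset.sum_le_sum fun i _ => Finset.abs_sum_le_sum_abs _ _
      _ ≤ ∑ _i : Fin n, ∑ _j : Fin n, M :=
          Finset.sum_le_sum fun i _ => Finset.sum_le_sum fun j _ => hM _
      _ = _ := by simp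
  calc _ ≤ (n : ℝ)⁻¹ * ((n : ℝ)⁻¹ * (n * (n * M))) := by gcongr
    _ = M := by field_simp

lemma det_cont {m : ℕ} (ℓ : Fin m) (p₀ : Fin m → ℝ × ℝ × ℝ)
    (hp : 0 < ∑ j, Real.sqrt ((p₀ j).1 + (p₀ j).2.1 - 2 * (p₀ j).2.2)) {ε : ℝ} (hε : 0 < ε) :
    ∃ δ > 0, ∀ p : Fin m → ℝ × ℝ × ℝ,
      (∀ j, |(p j).1 - (p₀ j).1| < δ ∧ |(p j).2.1 - (p₀ j).2.1| < δ ∧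
        |(p j).2.2 - (p₀ j).2.2| < δ) →
      |Real.sqrt ((p ℓ).1 + (p ℓ).2.1 - 2 * (p ℓ).2.2) /
          ∑ j, Real.sqrt ((p j).1 + (p j).2.1 - 2 * (p j).2.2) -
        Real.sqrt ((p₀ ℓ).1 + (p₀ ℓ).2.1 - 2 * (p₀ ℓ).2.2) /
          ∑ j, Real.sqrt ((p₀ j).1 + (p₀ j).2.1 - 2 * (p₀ j).2.2)| < ε := by
  have hc : ContinuousAt (fun p : Fin m → ℝ × ℝ × ℝ =>
      Real.sqrt ((p ℓ).1 + (p ℓ).2.1 - 2 * (p ℓ).2.2) /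
          ∑ j, Real.sqrt ((p j).1 + (p j).2.1 - 2 * (p j).2.2)) p₀ := by
    apply ContinuousAt.div
    · exact Continuous.continuousAt (by fun_prop)
    · exact Continuous.continuousAt (by fun_prop)
    · exact hp.ne'
  obtain ⟨δ, hδ, H⟩ := Metric.continuousAt_iff.1 hc ε hε
  refine ⟨δ, hδ, fun p h => ?_⟩
  have := H (x := p) ((dist_pi_lt_iff hδ).2 fun j => by
    simpa [Prod.dist_eq, Real.dist_eq] using h j)
  simpa [Real.dist_eq] using this

end MixAux

/-- Consistency of the MMD-based mixing coefficients (Corollary to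
Theorem 1).  The first `n` mutually independent i.i.d. samples `X₁,…,Xₙ ~ P`,
`Y₁,…,Yₙ ~ Q` are modelled by the product measure `(⊗ⁿ P) ⊗ (⊗ⁿ Q)`; for every `ℓ`,
`w_ℓ(P̂ⁿ,Q̂ⁿ) → w_ℓ(P,Q)` in probability. -/
theorem mixCoeff_consistency {X : Type*} [MeasurableSpace X] (m : ℕ)
    (k : Fin m → X × X → ℝ)
    (hk : ∀ ℓ, Measurable (k ℓ))
    (hsym : ∀ ℓ, ∀ x y : X, k ℓ (x, y) = k ℓ (y, x))
    (hpsd : ∀ ℓ, IsPSDKernel (k ℓ))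
    (hbdd : ∀ ℓ, ∃ M : ℝ, ∀ x y : X, |k ℓ (x, y)| ≤ M)
    (P Q : Measure X) [IsProbabilityMeasure P] [IsProbabilityMeasure Q]
    (hpos : 0 < ∑ j : Fin m, mmd (k j) P Q) :
    ∀ ℓ : Fin m, ∀ ε > (0 : ℝ),
      Tendsto (fun n : ℕ =>
          ((Measure.pi fun _ : Fin n => P).prod (Measure.pi fun _ : Fin n => Q))
            {ω | ε < |mixCoeff k ℓ (empMeasure ω.1) (empMeasure ω.2)
              - mixCoeff k ℓ P Q|})
        atTop (nhds 0) := by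
  intro ℓ ε hε
  choose M hM' using hbdd
  have hM : ∀ j z, |k j z| ≤ M j := fun j z => hM' j z.1 z.2
  obtain ⟨δ, hδ, H⟩ := MixAux.det_cont ℓ
    (fun j => (∫ z, k j z ∂(P.prod P), ∫ z, k j z ∂(Q.prod Q), ∫ z, k j z ∂(P.prod Q))) hpos hε
  have lim : Tendsto (fun n : ℕ => ∑ j : Fin m,
      (3 : ENNReal) * ENNReal.ofReal (16 * M j ^ 2 / n / δ ^ 2)) atTop (nhds 0) := by
    have h1 : ∀ j, Tendsto (fun n : ℕ =>
        (3 : ENNReal) * ENNReal.ofReal (16 * M j ^ 2 / n / δ ^ 2)) atTop (nhds 0) := by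
      intro j
      have h2 : Tendsto (fun n : ℕ => 16 * M j ^ 2 / (n : ℝ) / δ ^ 2) atTop (nhds 0) := by
        simpa using (tendsto_const_div_atTop_nhds_zero_nat (16 * M j ^ 2)).div_const (δ ^ 2)
      have h3 := ENNReal.Tendsto.const_mul (a := 3) (ENNReal.tendsto_ofReal h2)
        (Or.inr (by simp))
      simpa using h3
    simpa using tendsto_finsetSum Finset.univ fun j _ => h1 j
  refine tendsto_of_tendsto_of_tendsto_of_le_of_le' tendsto_const_nhds lim
    (Eventually.of_forall fun _ => zero_le) ?_
  filter_upwards [eventually_gt_atTop 0] with n hn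
  set μ := Measure.pi fun _ : Fin n => P with hμ
  set ν := Measure.pi fun _ : Fin n => Q with hν
  let A : Fin m → Set ((Fin n → X) × (Fin n → X)) := fun j =>
    {ω | δ ≤ |∫ z, k j z ∂((empMeasure ω.1).prod (empMeasure ω.1)) - ∫ z, k j z ∂(P.prod P)|}
  let B : Fin m → Set ((Fin n → X) × (Fin n → X)) := fun j =>
    {ω | δ ≤ |∫ z, k j z ∂((empMeasure ω.2).prod (empMeasure ω.2)) - ∫ z, k j z ∂(Q.prod Q)|}
  let C : Fin m → Set ((Fin n → X) × (Fin n → X)) := fun j =>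
    {ω | δ ≤ |∫ z, k j z ∂((empMeasure ω.1).prod (empMeasure ω.2)) - ∫ z, k j z ∂(P.prod Q)|}
  have hP : ∀ i, μ.map (fun ω => ω i) = P := fun i =>
    (measurePreserving_eval (fun _ : Fin n => P) i).map_eq
  have hQ : ∀ i, ν.map (fun ω => ω i) = Q := fun i =>
    (measurePreserving_eval (fun _ : Fin n => Q) i).map_eq
  have mf : Measurable (Prod.fst : (Fin n → X) × (Fin n → X) → _) := measurable_fst
  have ms : Measurable (Prod.snd : (Fin n → X) × (Fin n → X) → _) := measurable_snd
  have f1 : (μ.prod ν).map Prod.fst = μ := by simp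
  have f2 : (μ.prod ν).map Prod.snd = ν := by simp
  have hP' : ∀ i, (μ.prod ν).map (fun ω => ω.1 i) = P := fun i => by
    rw [← hP i]
    nth_rewrite 2 [← f1]
    rw [Measure.map_map (by fun_prop) mf]
    rfl
  have hQ' : ∀ i, (μ.prod ν).map (fun ω => ω.2 i) = Q := fun i => by
    rw [← hQ i]
    nth_rewrite 2 [← f2]
    rw [Measure.map_map (by fun_prop) ms]
    rfl
  have hA : ∀ j, (μ.prod ν) (A j) ≤ ENNReal.ofReal (16 * M j ^ 2 / n / δ ^ 2) := fun j =>
    (Measure.le_map_apply (μ := μ.prod ν) mf.aemeasurable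
      {x : Fin n → X | δ ≤ |∫ z, k j z ∂((empMeasure x).prod (empMeasure x))
        - ∫ z, k j z ∂(P.prod P)|}).trans (by
      rw [f1]
      exact MixAux.vstat_prob hn (U := id) (V := id) measurable_id measurable_id hP hP
        (MixAux.indep_pi_or P n) (fun i i' h => (MixAux.indep_pi P n).indepFun h) (hk j) (hM j) hδ)
  have hB : ∀ j, (μ.prod ν) (B j) ≤ ENNReal.ofReal (16 * M j ^ 2 / n / δ ^ 2) := fun j =>
    (Measure.le_map_apply (μ := μ.prod ν) ms.aemeasurable
      {x : Fin n → X | δ ≤ |∫ z, k j z ∂((empMeasure x).prod (empMeasure x))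
        - ∫ z, k j z ∂(Q.prod Q)|}).trans (by
      rw [f2]
      exact MixAux.vstat_prob hn (U := id) (V := id) measurable_id measurable_id hQ hQ
        (MixAux.indep_pi_or Q n) (fun i i' h => (MixAux.indep_pi Q n).indepFun h) (hk j) (hM j) hδ)
  have hC : ∀ j, (μ.prod ν) (C j) ≤ ENNReal.ofReal (16 * M j ^ 2 / n / δ ^ 2) := fun j =>
    MixAux.vstat_prob hn (U := Prod.fst) (V := Prod.snd) mf ms hP' hQ'
      (fun j i i' h => Or.inl (MixAux.indep_cross P Q n j i i' h))
      (fun i i' h => by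
        have h1 := (MixAux.indep_pi Q n).indepFun h
        rw [← hν, ← f2] at h1
        rw [ProbabilityTheory.indepFun_iff_map_prod_eq_prod_map_map
          (measurable_pi_apply i).aemeasurable (measurable_pi_apply i').aemeasurable] at h1
        rw [ProbabilityTheory.indepFun_iff_map_prod_eq_prod_map_map
          (by fun_prop) (by fun_prop)]
        rw [Measure.map_map (by fun_prop) ms, Measure.map_map (by fun_prop) ms,
          Measure.map_map (by fun_prop) ms] at h1
        exact h1) (hk j) (hM j) hδ
  calc _ ≤ (μ.prod ν) (⋃ j ∈ (Finset.univ : Finset (Fin m)), (A j ∪ (B j ∪ C j))) := by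
        apply measure_mono
        intro ω hω
        by_contra hcon
        simp only [Set.mem_iUnion, Set.mem_union, Finset.mem_univ, exists_prop, true_and,
          not_exists, not_or, A, B, C, Set.mem_ofPred_eq, not_le] at hcon
        have := H (fun j => (∫ z, k j z ∂((empMeasure ω.1).prod (empMeasure ω.1)),
          ∫ z, k j z ∂((empMeasure ω.2).prod (empMeasure ω.2)),
          ∫ z, k j z ∂((empMeasure ω.1).prod (empMeasure ω.2)))) hcon
        exact lt_asymm hω this
    _ ≤ ∑ j : Fin m, (μ.prod ν) (A j ∪ (B j ∪ C j)) := measure_biUnion_finset_le _ _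
    _ ≤ _ := by
        refine Finset.sum_le_sum fun j _ => ?_
        calc _ ≤ (μ.prod ν) (A j) + ((μ.prod ν) (B j) + (μ.prod ν) (C j)) :=
              (measure_union_le _ _).trans (add_le_add le_rfl (measure_union_le _ _))
          _ ≤ _ := add_le_add (hA j) (add_le_add (hB j) (hC j))
          _ = _ := by ring
end

section
/- Let Φ be a nonzero real n × p matrix, let ε = (ε₁,…,εₙ) have i.i.d. coordinates uniform on {−1, 1}, and write ‖Φ‖_F for the Frobenius norm and |||Φ|||₂ for the spectral norm (largest singular value) of Φ. Then for every ϱ ≥ 0: ℙ( ‖Φᵀ ε‖₂ − ‖Φ‖_F ≥ ϱ ) ≤ exp( − ϱ² / (192 · |||Φ|||₂²) ). -/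
open MeasureTheory

/-- Euclidean norm of a finite real vector. -/
noncomputable def vecNorm {n : ℕ} (v : Fin n → ℝ) : ℝ :=
  Real.sqrt (∑ i, (v i) ^ 2)

/-- Frobenius norm of a real matrix. -/
noncomputable def frobNorm {n p : ℕ} (A : Matrix (Fin n) (Fin p) ℝ) : ℝ :=
  Real.sqrt (∑ i, ∑ j, (A i j) ^ 2)

/-- Spectral norm (largest singular value) of a real matrix, as the operator norm
with respect to Euclidean norms. -/
noncomputable def specNorm {n p : ℕ} (A : Matrix (Fin n) (Fin p) ℝ) : ℝ :=
  sSup {r : ℝ | ∃ v : Fin p → ℝ, vecNorm v ≤ 1 ∧ r = vecNorm (A.mulVec v)}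

/-- Quadratic form of a matrix. -/
noncomputable def qf {n : ℕ} (M : Fin n → Fin n → ℝ) (v : Fin n → ℝ) : ℝ :=
  ∑ i, ∑ j, M i j * v i * v j

lemma qf_cons {n : ℕ} (M : Fin (n+1) → Fin (n+1) → ℝ) (hs : ∀ i j, M i j = M j i)
    (x : ℝ) (v : Fin n → ℝ) :
    qf M (Fin.cons x v) = M 0 0 * x ^ 2 + 2 * x * (∑ i, M 0 (Fin.succ i) * v i)
      + qf (fun i j => M i.succ j.succ) v := by
  unfold qf
  simp only [Fin.sum_univ_succ, Fin.cons_zero, Fin.cons_succ, Finset.sum_add_distrib]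
  have h1 : ∑ i : Fin n, M 0 i.succ * x * v i = x * ∑ i, M 0 (Fin.succ i) * v i := by
    rw [Finset.mul_sum]; exact Finset.sum_congr rfl fun i _ => by ring
  have h2 : ∑ i : Fin n, M i.succ 0 * v i * x = x * ∑ i, M 0 (Fin.succ i) * v i := by
    rw [Finset.mul_sum]; exact Finset.sum_congr rfl fun i _ => by rw [hs]; ring
  rw [h1, h2]; ring

lemma qf_add_rank {n : ℕ} (M : Fin n → Fin n → ℝ) (b v : Fin n → ℝ) :
    qf (fun i j => M i j + 2 * b i * b j) v = qf M v + 2 * (∑ i, b i * v i) ^ 2 := by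
  unfold qf
  rw [sq, Finset.sum_mul_sum, Finset.mul_sum, ← Finset.sum_add_distrib]
  refine Finset.sum_congr rfl fun i _ => ?_
  rw [Finset.mul_sum, ← Finset.sum_add_distrib]
  exact Finset.sum_congr rfl fun j _ => by ring

lemma mgf_bound (c : ℝ) (hc0 : 0 < c) (hc1 : c < 1) : ∀ (n : ℕ) (M : Fin n → Fin n → ℝ)
    (_ : ∀ i j, M i j = M j i) (_ : ∀ v, 0 ≤ qf M v)
    (_ : ∀ v, 2 * qf M v ≤ c * ∑ i, v i ^ 2),
    ∑ ω : Fin n → Bool, Real.exp (qf M fun i => if ω i then (1 : ℝ) else -1)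
      ≤ 2 ^ n * Real.exp ((∑ i, M i i) / (1 - c)) := by
  intro n
  induction n with
  | zero => intro M _ _ _; simp [qf]
  | succ n ih =>
    intro M hs hp hc
    set b : Fin n → ℝ := fun i => M 0 i.succ with hb
    set m := M 0 0 with hm
    set M' : Fin n → Fin n → ℝ := fun i j => M i.succ j.succ with hM'
    set M2 : Fin n → Fin n → ℝ := fun i j => M' i j + 2 * b i * b j with hM2
    have hq : ∀ x v, qf M (Fin.cons x v) = m * x ^ 2 + 2 * x * (∑ i, b i * v i) + qf M' v :=
      fun x v => qf_cons M hs x v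
    have hq2 : ∀ v, qf M2 v = qf M' v + 2 * (∑ i, b i * v i) ^ 2 := fun v => qf_add_rank M' b v
    have hp' : ∀ v, 0 ≤ qf M' v := by
      intro v
      have := hp (Fin.cons 0 v)
      rw [hq] at this; simpa using this
    have hm0 : 0 ≤ m := by
      have := hp (Fin.cons 1 0)
      rw [hq] at this; simpa [qf] using this
    have hc' : ∀ x v, 2 * (m * x ^ 2 + 2 * x * (∑ i, b i * v i) + qf M' v)
        ≤ c * (x ^ 2 + ∑ i, v i ^ 2) := by
      intro x v
      have := hc (Fin.cons x v)
      rw [hq, Fin.sum_univ_succ] at this; simpa using this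
    have hM2c : ∀ v, 2 * qf M2 v ≤ c * ∑ i, v i ^ 2 := by
      intro v
      have h := hc' (2 * ∑ i, b i * v i) v
      rw [hq2]
      nlinarith [mul_nonneg hm0 (sq_nonneg (∑ i, b i * v i)),
        mul_nonneg (sub_nonneg.2 hc1.le) (sq_nonneg (∑ i, b i * v i))]
    have hbb : 2 * ∑ i, b i ^ 2 ≤ c * m := by
      -- test vectors: w = (m, b), and c e0 - 2 w
      have h1 := hc' m b
      have h2 := hp (Fin.cons (c - 2 * m) (fun i => (-2) * b i))
      rw [hq] at h2
      have e1 : ∑ i, b i * b i = ∑ i, b i ^ 2 := Finset.sum_congr rfl fun i _ => by ring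
      have e2 : ∑ i, b i * ((-2) * b i) = -2 * ∑ i, b i ^ 2 := by
        rw [Finset.mul_sum]; exact Finset.sum_congr rfl fun i _ => by ring
      have e3 : qf M' (fun i => (-2) * b i) = 4 * qf M' b := by
        unfold qf
        rw [Finset.mul_sum]; refine Finset.sum_congr rfl fun i _ => ?_
        rw [Finset.mul_sum]; exact Finset.sum_congr rfl fun i _ => by ring
      rw [e2, e3] at h2
      rw [e1] at h1
      set B := ∑ i, b i ^ 2
      have h3 : 0 ≤ c * (c * m - 2 * B - 2 * m ^ 2) := by nlinarith
      have h4 := nonneg_of_mul_nonneg_right h3 hc0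
      nlinarith [sq_nonneg m]
    have IH := ih M2 (fun i j => by simp only [hM2, hM']; rw [hs i.succ j.succ]; ring)
      (fun v => by rw [hq2]; have := hp' v; positivity) hM2c
    have step : ∀ ω : Fin n → Bool,
        Real.exp (qf M fun i => if (Fin.cons true ω : Fin (n+1) → Bool) i then (1 : ℝ) else -1) +
        Real.exp (qf M fun i => if (Fin.cons false ω : Fin (n+1) → Bool) i then (1 : ℝ) else -1)
        ≤ 2 * Real.exp m * Real.exp (qf M2 fun i => if ω i then (1 : ℝ) else -1) := by
      intro ω
      have c1 : ∀ a : Bool, (fun i => if (Fin.cons a ω : Fin (n+1) → Bool) i then (1 : ℝ) else -1)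
          = Fin.cons (if a then (1:ℝ) else -1) (fun i => if ω i then (1 : ℝ) else -1) := by
        intro a; funext i
        refine Fin.cases ?_ (fun i => ?_) i <;> simp
      rw [c1, c1, hq, hq, hq2]
      set v : Fin n → ℝ := fun i => if ω i then (1 : ℝ) else -1
      set t := ∑ i, b i * v i
      have hcosh := Real.cosh_le_exp_half_sq (2 * t)
      rw [Real.cosh_eq] at hcosh
      have e1 : Real.exp (m * (if true = true then (1:ℝ) else -1) ^ 2
          + 2 * (if true = true then (1:ℝ) else -1) * t + qf M' v)
          = Real.exp m * Real.exp (qf M' v) * Real.exp (2 * t) := by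
        rw [← Real.exp_add, ← Real.exp_add]; congr 1; simp; ring
      have e2 : Real.exp (m * (if false = true then (1:ℝ) else -1) ^ 2
          + 2 * (if false = true then (1:ℝ) else -1) * t + qf M' v)
          = Real.exp m * Real.exp (qf M' v) * Real.exp (-(2 * t)) := by
        rw [← Real.exp_add, ← Real.exp_add]; congr 1; simp; ring
      have e3 : 2 * Real.exp m * Real.exp (qf M' v + 2 * t ^ 2)
          = Real.exp m * Real.exp (qf M' v) * (2 * Real.exp ((2 * t) ^ 2 / 2)) := by
        rw [Real.exp_add, show (2 * t) ^ 2 / 2 = 2 * t ^ 2 by ring]; ring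
      rw [e1, e2, e3, ← mul_add]
      refine mul_le_mul_of_nonneg_left ?_ (by positivity)
      linarith
    have hsum : ∑ ω : Fin (n+1) → Bool, Real.exp (qf M fun i => if ω i then (1 : ℝ) else -1)
        = ∑ ω : Fin n → Bool,
        (Real.exp (qf M fun i => if (Fin.cons true ω : Fin (n+1) → Bool) i then (1 : ℝ) else -1) +
        Real.exp (qf M fun i => if (Fin.cons false ω : Fin (n+1) → Bool) i then (1 : ℝ) else -1)) := by
      rw [← (Fin.consEquiv (fun _ : Fin (n+1) => Bool)).sum_comp, Fintype.sum_prod_type]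
      simp [Fin.consEquiv, Finset.sum_add_distrib]
      rfl
    rw [hsum]
    refine (Finset.sum_le_sum fun ω _ => step ω).trans ?_
    rw [← Finset.mul_sum]
    refine (mul_le_mul_of_nonneg_left IH (by positivity)).trans ?_
    have : 2 * Real.exp m * (2 ^ n * Real.exp ((∑ i, M2 i i) / (1 - c)))
        = 2 ^ (n+1) * Real.exp (m + (∑ i, M2 i i) / (1 - c)) := by
      rw [Real.exp_add]; ring
    rw [this]
    refine mul_le_mul_of_nonneg_left (Real.exp_le_exp.2 ?_) (by positivity)
    have htr : ∑ i, M2 i i = ∑ i : Fin n, M i.succ i.succ + 2 * ∑ i, b i ^ 2 := by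
      rw [Finset.mul_sum, ← Finset.sum_add_distrib]
      exact Finset.sum_congr rfl fun i _ => by simp only [hM2, hM']; ring
    have h1c : 0 < 1 - c := by linarith
    rw [htr, Fin.sum_univ_succ, ← hm, le_div_iff₀ h1c, add_mul, div_mul_cancel₀ _ h1c.ne']
    linarith

lemma vecNorm_sq {n : ℕ} (v : Fin n → ℝ) : vecNorm v ^ 2 = ∑ i, v i ^ 2 :=
  Real.sq_sqrt (Finset.sum_nonneg fun _ _ => sq_nonneg _)

lemma vecNorm_nonneg {n : ℕ} (v : Fin n → ℝ) : 0 ≤ vecNorm v := Real.sqrt_nonneg _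

lemma frobNorm_sq {n p : ℕ} (A : Matrix (Fin n) (Fin p) ℝ) :
    frobNorm A ^ 2 = ∑ i, ∑ j, (A i j) ^ 2 :=
  Real.sq_sqrt (Finset.sum_nonneg fun _ _ => Finset.sum_nonneg fun _ _ => sq_nonneg _)

lemma vecNorm_smul {n : ℕ} (a : ℝ) (ha : 0 ≤ a) (v : Fin n → ℝ) :
    vecNorm (a • v) = a * vecNorm v := by
  rw [← sq_eq_sq₀ (vecNorm_nonneg _) (mul_nonneg ha (vecNorm_nonneg _)), mul_pow, vecNorm_sq,
    vecNorm_sq, Finset.mul_sum]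
  exact Finset.sum_congr rfl fun i _ => by simp [mul_pow]

lemma vecNorm_mulVec_le_frob {n p : ℕ} (A : Matrix (Fin n) (Fin p) ℝ) (v : Fin p → ℝ) :
    vecNorm (A.mulVec v) ≤ frobNorm A * vecNorm v := by
  rw [← sq_le_sq₀ (vecNorm_nonneg _) (mul_nonneg (show 0 ≤ frobNorm A from Real.sqrt_nonneg _)
      (vecNorm_nonneg _)), mul_pow, vecNorm_sq, vecNorm_sq, frobNorm_sq, Finset.sum_mul]
  exact Finset.sum_le_sum fun i _ => Finset.sum_mul_sq_le_sq_mul_sq Finset.univ (fun j => A i j) v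

lemma vecNorm_mulVec_le {n p : ℕ} (A : Matrix (Fin n) (Fin p) ℝ) (v : Fin p → ℝ) :
    vecNorm (A.mulVec v) ≤ specNorm A * vecNorm v := by
  rcases (vecNorm_nonneg v).eq_or_lt with h | h
  · have := vecNorm_mulVec_le_frob A v
    rw [← h] at this ⊢; simpa using this
  · have hb : BddAbove {r : ℝ | ∃ v : Fin p → ℝ, vecNorm v ≤ 1 ∧ r = vecNorm (A.mulVec v)} := by
      refine ⟨frobNorm A, ?_⟩
      rintro r ⟨w, hw, rfl⟩
      exact (vecNorm_mulVec_le_frob A w).trans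
        (mul_le_of_le_one_right (Real.sqrt_nonneg _) hw)
    have hi : 0 ≤ (vecNorm v)⁻¹ := inv_nonneg.2 h.le
    have := le_csSup hb ⟨(vecNorm v)⁻¹ • v, by
      rw [vecNorm_smul _ hi, inv_mul_cancel₀ h.ne'], rfl⟩
    rw [Matrix.mulVec_smul, vecNorm_smul _ hi, inv_mul_le_iff₀ h, mul_comm] at this
    exact this

lemma vecNorm_transpose_sq_le {n p : ℕ} (A : Matrix (Fin n) (Fin p) ℝ) (v : Fin n → ℝ) :
    vecNorm (A.transpose.mulVec v) ^ 2 ≤ specNorm A ^ 2 * vecNorm v ^ 2 := by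
  set w := A.transpose.mulVec v with hw
  have h1 : vecNorm w ^ 2 = ∑ i, v i * A.mulVec w i := by
    have : w ⬝ᵥ w = v ⬝ᵥ A.mulVec w := by
      rw [Matrix.dotProduct_mulVec v, ← Matrix.mulVec_transpose]
    rw [vecNorm_sq]
    simpa [dotProduct, sq] using this
  have h2 : (vecNorm w ^ 2) ^ 2 ≤ vecNorm v ^ 2 * vecNorm (A.mulVec w) ^ 2 := by
    rw [h1, vecNorm_sq v, vecNorm_sq]
    exact Finset.sum_mul_sq_le_sq_mul_sq _ _ _
  have h3 : vecNorm (A.mulVec w) ^ 2 ≤ specNorm A ^ 2 * vecNorm w ^ 2 := by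
    rw [← mul_pow]
    exact pow_le_pow_left₀ (vecNorm_nonneg _) (vecNorm_mulVec_le A w) 2
  rcases (sq_nonneg (vecNorm w)).eq_or_lt with h | h
  · rw [← h]; positivity
  · have h4 := mul_le_mul_of_nonneg_left h3 (sq_nonneg (vecNorm v))
    nlinarith

lemma qf_gram {n p : ℕ} (l : ℝ) (A : Matrix (Fin n) (Fin p) ℝ) (v : Fin n → ℝ) :
    qf (fun i j => l * ∑ k, A i k * A j k) v = l * vecNorm (A.transpose.mulVec v) ^ 2 := by
  rw [vecNorm_sq]
  unfold qf
  simp only [Matrix.mulVec, dotProduct, Matrix.transpose_apply, sq, Finset.sum_mul_sum,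
    Finset.mul_sum, Finset.sum_mul]
  symm
  rw [Finset.sum_comm]
  refine Finset.sum_congr rfl fun i _ => ?_
  rw [Finset.sum_comm]
  exact Finset.sum_congr rfl fun j _ => Finset.sum_congr rfl fun k _ => by ring

/-- Concentration of `‖Φᵀ ε‖₂` for a Rademacher vector `ε` (Eq. (EXO2)
in the proof of Proposition 1).  The i.i.d. signs uniform on `{−1,1}` are encoded by
uniform Booleans; for every `ϱ ≥ 0`,
`ℙ( ‖Φᵀ ε‖₂ − ‖Φ‖_F ≥ ϱ ) ≤ exp(−ϱ²/(192 |||Φ|||₂²))`. -/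
theorem rademacher_image_norm_concentration (n p : ℕ)
    (Φ : Matrix (Fin n) (Fin p) ℝ) (hΦ : Φ ≠ 0) (ϱ : ℝ) (hϱ : 0 ≤ ϱ) :
    (Measure.pi fun _ : Fin n => (PMF.uniformOfFintype Bool).toMeasure)
        {ω | ϱ ≤ vecNorm (Φ.transpose.mulVec fun i => if ω i then (1 : ℝ) else -1)
              - frobNorm Φ}
      ≤ ENNReal.ofReal (Real.exp (-ϱ ^ 2 / (192 * (specNorm Φ) ^ 2))) := by
  set S := specNorm Φ with hS
  set F := frobNorm Φ with hF
  rcases hϱ.eq_or_lt with h0 | hpos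
  · rw [← h0]; simpa using prob_le_one
  rcases eq_or_ne S 0 with hS0 | hS0
  · rw [hS0]; simpa using prob_le_one
  have hFpos : 0 < F := by
    refine lt_of_le_of_ne (Real.sqrt_nonneg _) fun h => hΦ ?_
    have h2 := frobNorm_sq Φ
    rw [← hF, ← h] at h2
    ext i j
    have h3 : ∑ i, ∑ j, (Φ i j) ^ 2 = 0 := by rw [← h2]; norm_num
    have h4 := (Finset.sum_eq_zero_iff_of_nonneg
      (fun i _ => Finset.sum_nonneg fun j _ => sq_nonneg (Φ i j))).1 h3 i (Finset.mem_univ _)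
    have h4 := (Finset.sum_eq_zero_iff_of_nonneg (fun j _ => sq_nonneg (Φ i j))).1 h4
    simpa using h4 j (Finset.mem_univ _)
  have hS2 : 0 < S ^ 2 := by positivity
  set l := ϱ / (2 * S ^ 2 * (F + ϱ)) with hl
  set c := ϱ / (F + ϱ) with hc
  have hl0 : 0 < l := by positivity
  have hlc : 2 * l * S ^ 2 = c := by rw [hl, hc]; field_simp
  have hc0 : 0 < c := by positivity
  have hc1 : c < 1 := by rw [hc, div_lt_one (by positivity)]; linarith
  have key := mgf_bound c hc0 hc1 n (fun i j => l * ∑ k, Φ i k * Φ j k)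
    (fun i j => by simp only [mul_comm])
    (fun v => by rw [qf_gram]; positivity)
    (fun v => by
      rw [qf_gram, ← vecNorm_sq, ← hlc]
      nlinarith [mul_le_mul_of_nonneg_left (vecNorm_transpose_sq_le Φ v) hl0.le])
  have htr : ∑ i, l * ∑ k, Φ i k * Φ i k = l * F ^ 2 := by
    rw [frobNorm_sq, Finset.mul_sum]; simp only [sq]
  simp only [qf_gram, htr] at key
  have hexp : l * F ^ 2 / (1 - c) - l * (F + ϱ) ^ 2 = -ϱ ^ 2 / (2 * S ^ 2) := by
    have : 1 - c = F / (F + ϱ) := by rw [hc]; field_simp; ring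
    rw [this, hl]; field_simp; ring
  set T : Set (Fin n → Bool) := {ω | ϱ ≤ vecNorm (Φ.transpose.mulVec fun i =>
    if ω i then (1 : ℝ) else -1) - F} with hT
  classical
  have hμ : (Measure.pi fun _ : Fin n => (PMF.uniformOfFintype Bool).toMeasure) T
      = ENNReal.ofReal (∑ ω : Fin n → Bool, if ω ∈ T then (1/2 : ℝ) ^ n else 0) := by
    have hs : ∀ ω : Fin n → Bool,
        (Measure.pi fun _ : Fin n => (PMF.uniformOfFintype Bool).toMeasure) {ω}
          = ENNReal.ofReal ((1/2 : ℝ) ^ n) := by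
      intro ω
      rw [Measure.pi_singleton]
      simp [ENNReal.ofReal_pow, ENNReal.ofReal_inv_of_pos, ENNReal.inv_pow]
    have hTe : T = ((Finset.univ.filter (fun ω => ω ∈ T) : Finset (Fin n → Bool)) :
        Set (Fin n → Bool)) := by ext; simp
    rw [← Finset.sum_filter, ENNReal.ofReal_sum_of_nonneg (fun ω _ => by positivity)]
    conv_lhs => rw [hTe, ← sum_measure_singleton]
    exact Finset.sum_congr rfl fun ω _ => hs ω
  rw [hμ]
  refine ENNReal.ofReal_le_ofReal ?_
  have hpt : ∀ ω : Fin n → Bool, (if ω ∈ T then (1/2 : ℝ) ^ n else 0) ≤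
      (1/2 : ℝ) ^ n * Real.exp (-(l * (F + ϱ) ^ 2)) * Real.exp (l *
        vecNorm (Φ.transpose.mulVec fun i => if ω i then (1 : ℝ) else -1) ^ 2) := by
    intro ω
    split_ifs with h
    · rw [mul_assoc, ← Real.exp_add]
      refine le_mul_of_one_le_right (by positivity) (Real.one_le_exp ?_)
      have h' : F + ϱ ≤ vecNorm (Φ.transpose.mulVec fun i => if ω i then (1 : ℝ) else -1) := by
        have : ϱ ≤ _ := h
        linarith
      have := mul_le_mul_of_nonneg_left (pow_le_pow_left₀ (by positivity) h' 2) hl0.le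
      linarith
    · positivity
  refine (Finset.sum_le_sum fun ω _ => hpt ω).trans ?_
  rw [← Finset.mul_sum]
  refine (mul_le_mul_of_nonneg_left key (by positivity)).trans ?_
  have : (1/2 : ℝ) ^ n * Real.exp (-(l * (F + ϱ) ^ 2)) * (2 ^ n * Real.exp (l * F ^ 2 / (1 - c)))
      = Real.exp (-ϱ ^ 2 / (2 * S ^ 2)) := by
    rw [← hexp, sub_eq_add_neg (_ / _), Real.exp_add]
    have : (1/2 : ℝ) ^ n * 2 ^ n = 1 := by rw [← mul_pow]; norm_num
    linear_combination (Real.exp (-(l * (F + ϱ) ^ 2)) * Real.exp (l * F ^ 2 / (1 - c))) * this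
  rw [this]
  refine Real.exp_le_exp.2 ?_
  rw [neg_div, neg_div, neg_le_neg_iff]
  exact div_le_div_of_nonneg_left (by positivity) (by positivity) (by linarith)
end
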